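/- arXiv:0903.2716 — 2 statements merged into one kernel-verified Lean document; each statement's English description precedes it below -/
import Mathlib

section
/- Let α ∈ (0,1) with 1/α ∉ ℕ, let N = ⌊1/α⌋, let d ≥ 1, and let Γ = (Γ(1),…,Γ(d)) : ℝ → ℝ^d be a compactly supported α-Hölder path. Then there exists a family of real-valued functions Γ^n_{ts}(i_1,…,i_n), indexed by n ∈ {1,…,N}, words (i_1,…,i_n) ∈ {1,…,d}^n and (s,t) ∈ ℝ², such that: (0) Γ^1_{ts}(i) = Γ_t(i) − Γ_s(i) for all i, s, t; (i) (Hölder) for each n and each word, sup_{s≠t} |Γ^n_{ts}(i_1,…,i_n)| / |t−s|^{nα} < ∞; (ii) (Chen) for all s,u,t ∈ ℝ and 2 ≤ n ≤ N, Γ^n_{ts}(i_1,…,i_n) − Γ^n_{tu}(i_1,…,i_n) − Γ^n_{us}(i_1,…,i_n) = Σ_{k=1}^{n−1} Γ^k_{tu}(i_1,…,i_k) · Γ^{n−k}_{us}(i_{k+1},…,i_n); (iii) (shuffle) whenever n_1 + n_2 ≤ N, Γ^{n_1}_{ts}(i_1,…,i_{n_1}) · Γ^{n_2}_{ts}(j_1,…,j_{n_2})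 = Σ_S Γ^{n_1+n_2}_{ts}(k^S), the sum over all subsets S ⊆ {1,…,n_1+n_2} with |S| = n_1. -/
/-- The word of length `n₁ + n₂` obtained by placing the letters of `u` in order at the
positions of `S` and the letters of `v` in order at the remaining positions. -/
noncomputable def shuffleWord {d n₁ n₂ : ℕ} (u : Fin n₁ → Fin d) (v : Fin n₂ → Fin d)
    (S : Finset (Fin (n₁ + n₂))) (hS : S.card = n₁) (m : Fin (n₁ + n₂)) : Fin d :=
  if hm : m ∈ S then u ((S.orderIsoOfFin hS).symm ⟨m, hm⟩)
  else v ((Sᶜ.orderIsoOfFin (by rw [Finset.card_compl, hS, Fintype.card_fin]; omega)).symm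
      ⟨m, Finset.mem_compl.mpr hm⟩)

section WordSeries

variable {A : Type*}

/-- Evaluation of `a` on the shuffle product of two words. -/
def shuffleEval : (List A → ℝ) → List A → List A → ℝ
  | a, [], v => a v
  | a, x :: u, [] => a (x :: u)
  | a, x :: u, y :: v =>
      shuffleEval (fun w => a (x :: w)) u (y :: v) + shuffleEval (fun w => a (y :: w)) (x :: u) v
  termination_by _ u v => u.length + v.length

/-- Convolution of series in words, dual to deconcatenation. -/
def conv (a b : List A → ℝ) (w : List A) : ℝ :=
  ∑ k ∈ Finset.range (w.length + 1), a (w.take k) * b (w.drop k)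

/-- The unit of the convolution product. -/
def convOne : List A → ℝ
  | [] => 1
  | _ :: _ => 0

/-- The characters of the shuffle algebra. -/
def IsGroupLike (a : List A → ℝ) : Prop :=
  a [] = 1 ∧ ∀ u v, shuffleEval a u v = a u * a v

@[simp] lemma shuffleEval_nil_left (a : List A → ℝ) (v : List A) : shuffleEval a [] v = a v := by
  simp [shuffleEval]

@[simp] lemma shuffleEval_nil_right (a : List A → ℝ) (u : List A) : shuffleEval a u [] = a u := by
  cases u <;> simp [shuffleEval]

lemma shuffleEval_cons_cons (a : List A → ℝ) (x y : A) (u v : List A) :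
    shuffleEval a (x :: u) (y :: v) = shuffleEval (fun w => a (x :: w)) u (y :: v) +
      shuffleEval (fun w => a (y :: w)) (x :: u) v := by
  rw [shuffleEval]

lemma shuffleEval_add (a b : List A → ℝ) (u v : List A) :
    shuffleEval (fun w => a w + b w) u v = shuffleEval a u v + shuffleEval b u v := by
  induction u generalizing a b v with
  | nil => simp
  | cons x u ihu =>
    induction v generalizing a b with
    | nil => simp
    | cons y v ihv =>
      simp only [shuffleEval_cons_cons, ihu, ihv]
      ring

lemma shuffleEval_const_mul (c : ℝ) (a : List A → ℝ) (u v : List A) :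
    shuffleEval (fun w => c * a w) u v = c * shuffleEval a u v := by
  induction u generalizing a v with
  | nil => simp
  | cons x u ihu =>
    induction v generalizing a with
    | nil => simp
    | cons y v ihv =>
      simp only [shuffleEval_cons_cons, ihu, ihv]
      ring

lemma shuffleEval_congr {a b : List A → ℝ} {u v : List A}
    (h : ∀ w, w.length = u.length + v.length → a w = b w) :
    shuffleEval a u v = shuffleEval b u v := by
  induction u generalizing a b v with
  | nil => simpa using h v (by simp)
  | cons x u ihu =>
    induction v generalizing a b with
    | nil => simpa using h (x :: u) (by simp)
    | cons y v ihv =>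
      rw [shuffleEval_cons_cons, shuffleEval_cons_cons, ihu, ihv]
      · intro w hw
        exact h _ (by simp at hw ⊢; omega)
      · intro w hw
        exact h _ (by simp at hw ⊢; omega)

lemma shuffleEval_length_mul (a : List A → ℝ) (u v : List A) :
    shuffleEval (fun w => (w.length : ℝ) * a w) u v =
      ((u.length : ℝ) + v.length) * shuffleEval a u v := by
  rw [← shuffleEval_const_mul]
  refine shuffleEval_congr fun w hw => ?_
  rw [hw]
  push_cast
  rfl

lemma shuffleEval_eq_zero {a : List A → ℝ} {u v : List A}
    (h : ∀ w, w.length = u.length + v.length → a w = 0) : shuffleEval a u v = 0 := by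
  rw [shuffleEval_congr (b := fun w => 0 * a w) (fun w hw => by simp [h w hw]),
    shuffleEval_const_mul, zero_mul]

lemma shuffleEval_convOne (u v : List A) :
    shuffleEval convOne u v = convOne u * convOne v := by
  cases u with
  | nil => simp [convOne]
  | cons x u =>
    rw [shuffleEval_eq_zero]
    · simp [convOne]
    · rintro (_ | ⟨y, w⟩) hw
      · simp at hw; omega
      · rfl

@[simp] lemma conv_nil (a b : List A → ℝ) : conv a b [] = a [] * b [] := by
  simp [conv]

lemma conv_cons (a b : List A → ℝ) (x : A) (w : List A) :
    conv a b (x :: w) = a [] * b (x :: w) + conv (fun w => a (x :: w)) b w := by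
  rw [conv, List.length_cons, Finset.sum_range_succ', add_comm]
  simp [conv]

lemma conv_add_left (a b c : List A → ℝ) (w : List A) :
    conv (fun w => a w + b w) c w = conv a c w + conv b c w := by
  simp [conv, add_mul, Finset.sum_add_distrib]

lemma conv_const_mul_left (r : ℝ) (a c : List A → ℝ) (w : List A) :
    conv (fun w => r * a w) c w = r * conv a c w := by
  simp [conv, mul_assoc, Finset.mul_sum]

lemma conv_assoc (a b c : List A → ℝ) : conv (conv a b) c = conv a (conv b c) := by
  funext w
  induction w generalizing a b with
  | nil => simp [mul_assoc]
  | cons x w ih =>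
    simp only [conv_cons, conv_nil, conv_add_left, conv_const_mul_left, ih]
    ring

lemma convOne_conv (a : List A → ℝ) : conv convOne a = a := by
  funext w
  cases w with
  | nil => simp [convOne]
  | cons x w =>
    rw [conv_cons]
    simp [convOne, conv]

lemma conv_convOne (a : List A → ℝ) : conv a convOne = a := by
  funext w
  induction w generalizing a with
  | nil => simp [convOne]
  | cons x w ih => simp [conv_cons, convOne, ih]

/-- The deconcatenation coproduct is multiplicative for the shuffle product. -/
lemma shuffleEval_conv (a b : List A → ℝ) (u v : List A) :
    shuffleEval (conv a b) u v =
      ∑ i ∈ Finset.range (u.length + 1), ∑ j ∈ Finset.range (v.length + 1),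
        shuffleEval a (u.take i) (v.take j) * shuffleEval b (u.drop i) (v.drop j) := by
  induction u generalizing a v with
  | nil => simp [conv]
  | cons x u ihu =>
    induction v generalizing a with
    | nil => simp [conv]
    | cons y v ihv =>
      simp only [shuffleEval_cons_cons, conv_cons, shuffleEval_add, shuffleEval_const_mul, ihu, ihv]
      simp only [List.length_cons, Finset.sum_range_succ' _ (_ + 1), List.take_succ_cons,
        List.drop_succ_cons, List.take_zero, List.drop_zero, shuffleEval_nil_left,
        shuffleEval_nil_right, shuffleEval_cons_cons, Finset.sum_add_distrib, add_mul]
      ring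

lemma IsGroupLike.conv {a b : List A → ℝ} (ha : IsGroupLike a) (hb : IsGroupLike b) :
    IsGroupLike (conv a b) := by
  refine ⟨by simp [ha.1, hb.1], fun u v => ?_⟩
  rw [shuffleEval_conv, _root_.conv, _root_.conv, Finset.sum_mul_sum]
  refine Finset.sum_congr rfl fun i _ => Finset.sum_congr rfl fun j _ => ?_
  rw [ha.2, hb.2]
  ring

/-- The series with constant term `1` solving
`b w = c |w| * ∑ p w₁ * b w₂` over the splittings `w = w₁ w₂` with `w₁` nonempty. -/
noncomputable def convSolve (p : List A → ℝ) (c : ℕ → ℝ) : List A → ℝ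
  | [] => 1
  | x :: w => c (w.length + 1) * ∑ k ∈ Finset.range (w.length + 1),
      p (x :: w.take k) * convSolve p c (w.drop k)
  termination_by w => w.length
  decreasing_by simp only [List.length_drop, List.length_cons]; omega

@[simp] lemma convSolve_nil (p : List A → ℝ) (c : ℕ → ℝ) : convSolve p c [] = 1 := by
  rw [convSolve]

lemma convSolve_cons (p : List A → ℝ) (c : ℕ → ℝ) (x : A) (w : List A) :
    convSolve p c (x :: w) =
      c (w.length + 1) * conv (fun w => p (x :: w)) (convSolve p c) w := by
  rw [convSolve, _root_.conv]

/-- The convolution inverse of a series with constant term `1`. -/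
noncomputable def convInv (a : List A → ℝ) : List A → ℝ :=
  convSolve a fun _ => -1

@[simp] lemma convInv_nil (a : List A → ℝ) : convInv a [] = 1 := convSolve_nil _ _

lemma conv_convInv {a : List A → ℝ} (ha : a [] = 1) : conv a (convInv a) = convOne := by
  funext w
  cases w with
  | nil => simp [ha, convOne]
  | cons x w => simp [conv_cons, ha, convInv, convSolve_cons, convOne]

lemma convInv_conv {a : List A → ℝ} (ha : a [] = 1) : conv (convInv a) a = convOne := by
  have h : convInv (convInv a) = a := by
    rw [← convOne_conv (convInv (convInv a)), ← conv_convInv ha, conv_assoc,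
      conv_convInv (convInv_nil a), conv_convOne]
  simpa only [h] using conv_convInv (convInv_nil a)

lemma IsGroupLike.convInv {a : List A → ℝ} (ha : IsGroupLike a) : IsGroupLike (convInv a) := by
  refine ⟨convInv_nil a, fun u v => sub_eq_zero.mp ?_⟩
  set b := _root_.convInv a with hb
  induction hn : u.length + v.length using Nat.strong_induction_on generalizing u v with
  | _ n ih =>
  have key : ∑ i ∈ Finset.range (u.length + 1), ∑ j ∈ Finset.range (v.length + 1),
      a (u.take i) * a (v.take j) *
        (shuffleEval b (u.drop i) (v.drop j) - b (u.drop i) * b (v.drop j)) = 0 := by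
    have h1 := shuffleEval_conv a b u v
    have h2 : _root_.conv a b u * _root_.conv a b v = _ :=
      Finset.sum_mul_sum _ _ _ _
    rw [conv_convInv ha.1] at h1 h2
    rw [shuffleEval_convOne, h2] at h1
    rw [← sub_eq_zero.mpr h1.symm, ← Finset.sum_sub_distrib]
    refine Finset.sum_congr rfl fun i _ => ?_
    rw [← Finset.sum_sub_distrib]
    refine Finset.sum_congr rfl fun j _ => ?_
    rw [ha.2]
    ring
  rw [Finset.sum_eq_single_of_mem 0 (by simp), Finset.sum_eq_single_of_mem 0 (by simp)] at key
  · simpa [ha.1] using key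
  · intro j hj hj0
    rw [ih _ _ _ _ rfl, mul_zero]
    simp at hj ⊢
    omega
  · intro i hi hi0
    refine Finset.sum_eq_zero fun j _ => ?_
    rw [ih _ _ _ _ rfl, mul_zero]
    simp at hi ⊢
    omega

/-- The exponential-type series of `z`, the solution of `|w| * e w = (z * e) w`. -/
noncomputable def convExp (z : List A → ℝ) : List A → ℝ :=
  convSolve z fun n => (n : ℝ)⁻¹

lemma length_mul_convExp {z : List A → ℝ} (hz : z [] = 0) (w : List A) :
    (w.length : ℝ) * convExp z w = conv z (convExp z) w := by
  cases w with
  | nil => simp [hz]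
  | cons x w =>
    rw [conv_cons, hz, convExp, convSolve_cons, List.length_cons, mul_inv_cancel_left₀]
    · simp
    · positivity

lemma isGroupLike_convExp {z : List A → ℝ} (hz : z [] = 0)
    (hsh : ∀ u v, u ≠ [] → v ≠ [] → shuffleEval z u v = 0) : IsGroupLike (convExp z) := by
  have h1 : convExp z [] = 1 := convSolve_nil _ _
  refine ⟨h1, fun u v => ?_⟩
  induction hn : u.length + v.length using Nat.strong_induction_on generalizing u v with
  | _ n ih =>
  obtain _ | ⟨x, u⟩ := u
  · simp [h1]
  obtain _ | ⟨y, v⟩ := v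
  · simp [h1]
  have hpos : (((x :: u).length : ℝ) + ((y :: v).length : ℝ)) ≠ 0 := by
    simp only [List.length_cons]
    positivity
  apply mul_left_cancel₀ hpos
  rw [← shuffleEval_length_mul, funext (length_mul_convExp hz), shuffleEval_conv, add_mul,
    ← mul_assoc, length_mul_convExp hz, mul_left_comm, length_mul_convExp hz, conv_cons, conv_cons,
    hz, _root_.conv, _root_.conv]
  simp only [List.length_cons, Finset.sum_range_succ' _ (_ + 1), List.take_succ_cons,
    List.drop_succ_cons, List.take_zero, List.drop_zero, shuffleEval_nil_left,
    shuffleEval_nil_right, hsh _ _ (List.cons_ne_nil _ _) (List.cons_ne_nil _ _), hz, zero_mul,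
    Finset.sum_const_zero, zero_add, add_zero]
  rw [Finset.sum_mul, Finset.mul_sum]
  congr 1
  · refine Finset.sum_congr rfl fun i _ => ?_
    rw [ih _ _ _ _ rfl, mul_assoc]
    simp at hn ⊢
    omega
  · refine Finset.sum_congr rfl fun i _ => ?_
    rw [ih _ _ _ _ rfl, mul_left_comm]
    simp at hn ⊢
    omega

/-- Perturbing the left factor in degree `m` perturbs the product in degree `m` only, up to
higher order terms. -/
lemma conv_perturb_left {m : ℕ} {a a' b z : List A → ℝ} (hb : b [] = 1)
    (h : ∀ w, w.length ≤ m → a' w = a w + if w.length = m then z w else 0)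
    {w : List A} (hw : w.length ≤ m) :
    conv a' b w = conv a b w + if w.length = m then z w else 0 := by
  have h1 : conv a' b w = conv a b w + ∑ k ∈ Finset.range (w.length + 1),
      (if (w.take k).length = m then z (w.take k) else 0) * b (w.drop k) := by
    rw [conv, conv, ← Finset.sum_add_distrib]
    refine Finset.sum_congr rfl fun k _ => ?_
    rw [h _ (by simp; omega), add_mul]
  rw [h1, Finset.sum_eq_single_of_mem w.length (by simp)]
  · simp [hb]
  · intro k hk hk'
    rw [if_neg, zero_mul]
    simp at hk ⊢
    omega

lemma conv_perturb_right {m : ℕ} {a b b' z : List A → ℝ} (ha : a [] = 1)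
    (h : ∀ w, w.length ≤ m → b' w = b w + if w.length = m then z w else 0)
    {w : List A} (hw : w.length ≤ m) :
    conv a b' w = conv a b w + if w.length = m then z w else 0 := by
  have h1 : conv a b' w = conv a b w + ∑ k ∈ Finset.range (w.length + 1),
      a (w.take k) * (if (w.drop k).length = m then z (w.drop k) else 0) := by
    rw [conv, conv, ← Finset.sum_add_distrib]
    refine Finset.sum_congr rfl fun k _ => ?_
    rw [h _ (by simp; omega), mul_add]
  rw [h1, Finset.sum_eq_single_of_mem 0 (by simp)]
  · simp [ha]
  · intro k hk hk'
    rw [if_neg, mul_zero]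
    simp at hk ⊢
    omega

/-- A function on words of length `m` vanishing on shuffles is the lowest order term of a
group-like series. -/
lemma exists_isGroupLike_of_homogeneous {m : ℕ} (hm : 1 ≤ m) (z : List A → ℝ)
    (hz : ∀ u v, u ≠ [] → v ≠ [] → u.length + v.length = m → shuffleEval z u v = 0) :
    ∃ e, IsGroupLike e ∧
      ∀ w, w.length ≤ m → e w = convOne w + if w.length = m then z w else 0 := by
  set Z : List A → ℝ := fun w => if w.length = m then (m : ℝ) * z w else 0 with hZ
  have hZ0 : ∀ w, w.length ≠ m → Z w = 0 := fun w hw => if_neg hw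
  have hZnil : Z [] = 0 := hZ0 _ (by simp; omega)
  have hexp : convExp Z [] = 1 := convSolve_nil _ _
  refine ⟨convExp Z, isGroupLike_convExp hZnil fun u v hu hv => ?_, fun w hw => ?_⟩
  · by_cases h : u.length + v.length = m
    · rw [shuffleEval_congr (b := fun w => (m : ℝ) * z w) fun w hw => if_pos (hw.trans h),
        shuffleEval_const_mul, hz u v hu hv h, mul_zero]
    · exact shuffleEval_eq_zero fun w hw => hZ0 w (hw ▸ h)
  · have h := conv_perturb_left (a := fun _ => 0) (a' := Z) (z := fun w => (m : ℝ) * z w)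
      (b := convExp Z) hexp (fun w _ => by simp [hZ]) hw
    rw [← length_mul_convExp hZnil] at h
    obtain _ | ⟨x, w⟩ := w
    · rw [if_neg (by simp; omega)]
      simp [hexp, convOne]
    · have hpos : ((x :: w).length : ℝ) ≠ 0 := by
        simp only [List.length_cons]
        positivity
      apply mul_left_cancel₀ hpos
      rw [h]
      split_ifs with h'
      · rw [h']
        simp [conv, convOne]
      · simp [conv, convOne]

lemma conv_conv_convInv {a b c : List A → ℝ} (hb : b [] = 1) :
    conv (conv a (convInv b)) (conv b (convInv c)) = conv a (convInv c) := by
  rw [conv_assoc, ← conv_assoc (convInv b), convInv_conv hb, convOne_conv]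

/-- Effect on increments of a multiplicative perturbation in degree `m`. -/
lemma conv_convInv_perturb {m : ℕ} {a a' b b' y z : List A → ℝ}
    (ha0 : a [] = 1) (hb0 : b [] = 1) (hb0' : b' [] = 1)
    (ha : ∀ w, w.length ≤ m → a' w = a w + if w.length = m then y w else 0)
    (hb : ∀ w, w.length ≤ m → b' w = b w + if w.length = m then z w else 0)
    {w : List A} (hw : w.length ≤ m) :
    conv a' (convInv b') w = conv a (convInv b) w + if w.length = m then y w - z w else 0 := by
  have h1 : ∀ w, w.length ≤ m →
      conv b (convInv b') w = convOne w + if w.length = m then -z w else 0 := by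
    intro w hw
    have := conv_perturb_left (convInv_nil b') hb hw
    rw [conv_convInv hb0'] at this
    rw [this]
    split_ifs <;> ring
  rw [conv_perturb_left (convInv_nil b') ha hw, ← conv_conv_convInv hb0,
    conv_perturb_right (by simp [ha0]) h1 hw, conv_convOne]
  split_ifs <;> ring

end WordSeries

section ShuffleWord

variable {A : Type*}

/-- The word obtained by reading a sequence `u` along the positions in `S` and a sequence `v`
along the other positions. -/
def mergeWord (u v : ℕ → A) {n : ℕ} (S : Finset (Fin n)) (m : Fin n) : A :=
  if m ∈ S then u (S.filter (· < m)).card else v (Sᶜ.filter (· < m)).card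

lemma orderIsoOfFin_symm_val {n k : ℕ} (S : Finset (Fin n)) (hS : S.card = k) (m : Fin n)
    (hm : m ∈ S) : ((S.orderIsoOfFin hS).symm ⟨m, hm⟩ : ℕ) = (S.filter (· < m)).card := by
  set e := S.orderIsoOfFin hS with he
  set i := e.symm ⟨m, hm⟩ with hi
  have hei : (e i : Fin n) = m := by simp [hi]
  rw [← Fin.card_Iio i]
  refine Finset.card_bij (fun j _ => (e j : Fin n)) ?_ ?_ ?_
  · intro j hj
    rw [Finset.mem_filter]
    refine ⟨(e j).2, ?_⟩
    rw [← hei]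
    exact e.strictMono (Finset.mem_Iio.mp hj)
  · intro j _ j' _ h
    exact e.injective (Subtype.ext h)
  · intro x hx
    rw [Finset.mem_filter] at hx
    refine ⟨e.symm ⟨x, hx.1⟩, ?_, by simp⟩
    rw [Finset.mem_Iio, hi]
    exact e.symm.strictMono hx.2

lemma shuffleWord_eq_mergeWord {d n₁ n₂ : ℕ} (u : Fin n₁ → Fin d) (v : Fin n₂ → Fin d)
    (u' v' : ℕ → Fin d) (hu : ∀ i : Fin n₁, u' i = u i) (hv : ∀ i : Fin n₂, v' i = v i)
    (S : Finset (Fin (n₁ + n₂))) (hS : S.card = n₁) :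
    shuffleWord u v S hS = mergeWord u' v' S := by
  funext m
  unfold shuffleWord mergeWord
  split_ifs with hm
  · rw [← hu, orderIsoOfFin_symm_val]
  · rw [← hv, orderIsoOfFin_symm_val]

lemma card_filter_lt_succ_map {n : ℕ} (S : Finset (Fin n)) (m : Fin n) :
    ((S.map (Fin.succEmb n)).filter (· < m.succ)).card = (S.filter (· < m)).card := by
  rw [Finset.filter_map, Finset.card_map]
  congr 1
  ext j
  rw [Finset.mem_filter, Finset.mem_filter, Function.comp_apply, Fin.coe_succEmb, Fin.succ_lt_succ_iff]

lemma ofFn_mergeWord_insert (u v : ℕ → A) {n : ℕ} (S : Finset (Fin n)) :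
    List.ofFn (mergeWord u v (insert 0 (S.map (Fin.succEmb n)))) =
      u 0 :: List.ofFn (mergeWord (fun i => u (i + 1)) v S) := by
  have hc : (insert 0 (S.map (Fin.succEmb n)))ᶜ = Sᶜ.map (Fin.succEmb n) := by
    ext j
    cases j using Fin.cases <;> simp
  have h0 : (0 : Fin (n + 1)) ∉ S.map (Fin.succEmb n) := by simp
  rw [List.ofFn_succ]
  congr 2
  · simp [mergeWord]
  · funext m
    have hm : m.succ ∈ insert 0 (S.map (Fin.succEmb n)) ↔ m ∈ S := by simp
    unfold mergeWord
    rw [hc, card_filter_lt_succ_map, Finset.filter_insert, if_pos m.succ_pos,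
      Finset.card_insert_of_notMem (fun h => h0 (Finset.mem_filter.mp h).1),
      card_filter_lt_succ_map]
    simp only [hm]

lemma ofFn_mergeWord_map (u v : ℕ → A) {n : ℕ} (S : Finset (Fin n)) :
    List.ofFn (mergeWord u v (S.map (Fin.succEmb n))) =
      v 0 :: List.ofFn (mergeWord u (fun i => v (i + 1)) S) := by
  have hc : (S.map (Fin.succEmb n))ᶜ = insert 0 (Sᶜ.map (Fin.succEmb n)) := by
    ext j
    cases j using Fin.cases <;> simp
  have h0 : (0 : Fin (n + 1)) ∉ Sᶜ.map (Fin.succEmb n) := by simp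
  rw [List.ofFn_succ]
  congr 2
  · simp [mergeWord]
  · funext m
    have hm : m.succ ∈ S.map (Fin.succEmb n) ↔ m ∈ S := by simp
    unfold mergeWord
    rw [hc, card_filter_lt_succ_map, Finset.filter_insert, if_pos m.succ_pos,
      Finset.card_insert_of_notMem (fun h => h0 (Finset.mem_filter.mp h).1),
      card_filter_lt_succ_map]
    simp only [hm]

lemma univ_fin_succ_eq (n : ℕ) :
    (Finset.univ : Finset (Fin (n + 1))) = insert 0 (Finset.univ.map (Fin.succEmb n)) := by
  ext j
  cases j using Fin.cases <;> simp

lemma sum_powersetCard_succ {n : ℕ} (f : Finset (Fin (n + 1)) → ℝ) (k : ℕ) :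
    ∑ S ∈ Finset.powersetCard (k + 1) Finset.univ, f S =
      ∑ S ∈ Finset.powersetCard (k + 1) Finset.univ, f (S.map (Fin.succEmb n)) +
      ∑ S ∈ Finset.powersetCard k Finset.univ, f (insert 0 (S.map (Fin.succEmb n))) := by
  have h0 : ∀ S : Finset (Fin n), (0 : Fin (n + 1)) ∉ S.map (Fin.succEmb n) := by simp
  rw [univ_fin_succ_eq, Finset.powersetCard_succ_insert (h0 _), Finset.sum_union,
    Finset.powersetCard_map, Finset.sum_map, Finset.powersetCard_map, Finset.sum_image,
    Finset.sum_map]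
  · rfl
  · intro S hS T hT h
    simp only [Finset.coe_map, Set.mem_image] at hS hT
    obtain ⟨S, _, rfl⟩ := hS
    obtain ⟨T, _, rfl⟩ := hT
    have h1 := congrArg (Finset.erase · 0) h
    simpa only [RelEmbedding.coe_toEmbedding, Finset.mapEmbedding_apply,
      Finset.erase_insert (h0 _)] using h1
  · rw [Finset.disjoint_left]
    intro S hS hS'
    rw [Finset.mem_image] at hS'
    obtain ⟨T, _, rfl⟩ := hS'
    exact h0 _ ((Finset.mem_powersetCard.mp hS).1 (Finset.mem_insert_self _ _))

lemma sum_powersetCard_mergeWord (a : List A → ℝ) (u v : ℕ → A) (n₁ n₂ n : ℕ) (h : n₁ + n₂ = n) :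
    ∑ S ∈ Finset.powersetCard n₁ (Finset.univ : Finset (Fin n)), a (List.ofFn (mergeWord u v S)) =
      shuffleEval a (List.ofFn fun i : Fin n₁ => u i) (List.ofFn fun i : Fin n₂ => v i) := by
  induction n generalizing a u v n₁ n₂ with
  | zero =>
    obtain ⟨rfl, rfl⟩ : n₁ = 0 ∧ n₂ = 0 := by omega
    simp
  | succ n ih =>
    obtain _ | n₁ := n₁
    · obtain rfl : n₂ = n + 1 := by omega
      have := ih (fun w => a (v 0 :: w)) u (fun i => v (i + 1)) 0 n (by omega)
      simp [-List.ofFn_succ] at this ⊢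
      have h2 := ofFn_mergeWord_map u v (∅ : Finset (Fin n))
      rw [Finset.map_empty] at h2
      rw [h2, this, List.ofFn_succ]
      rfl
    · rw [sum_powersetCard_succ]
      simp only [ofFn_mergeWord_map, ofFn_mergeWord_insert]
      rw [ih (fun w => a (u 0 :: w)) _ _ n₁ n₂ (by omega)]
      obtain _ | n₂ := n₂
      · rw [Finset.powersetCard_eq_empty.mpr (by simp; omega)]
        simp
      · rw [ih (fun w => a (v 0 :: w)) _ _ (n₁ + 1) n₂ (by omega)]
        simp only [List.ofFn_succ, shuffleEval_cons_cons, Fin.val_zero, Fin.val_succ]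
        ring

lemma sum_shuffleWord {d n₁ n₂ : ℕ} (h₁ : 1 ≤ n₁) (a : List (Fin d) → ℝ) (u : Fin n₁ → Fin d)
    (v : Fin n₂ → Fin d) :
    ∑ S : {S : Finset (Fin (n₁ + n₂)) // S.card = n₁}, a (List.ofFn (shuffleWord u v S.1 S.2)) =
      shuffleEval a (List.ofFn u) (List.ofFn v) := by
  set u' : ℕ → Fin d := fun i => if h : i < n₁ then u ⟨i, h⟩ else u ⟨0, h₁⟩ with hu'
  set v' : ℕ → Fin d := fun i => if h : i < n₂ then v ⟨i, h⟩ else u ⟨0, h₁⟩ with hv'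
  have hu : ∀ i : Fin n₁, u' i = u i := fun i => by simp [hu']
  have hv : ∀ i : Fin n₂, v' i = v i := fun i => by simp [hv']
  have := sum_powersetCard_mergeWord a u' v' n₁ n₂ _ rfl
  simp only [hu, hv] at this
  rw [← this]
  simp only [shuffleWord_eq_mergeWord u v u' v' hu hv]
  exact (Finset.sum_subtype _ (by simp)
    fun S : Finset (Fin (n₁ + n₂)) => a (List.ofFn (mergeWord u' v' S))).symm

end ShuffleWord

section DyadicPrimitive

open Filter Topology

/-- Values at the points `k / 2 ^ m` of an approximate primitive of `F`: the value at a new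
midpoint is chosen so as to split the error on an interval evenly between its two halves. -/
noncomputable def dyadicPrimitive (F : ℝ → ℝ → ℝ) : ℕ → ℕ → ℝ
  | 0, _ => 0
  | m + 1, k =>
      if k % 2 = 0 then dyadicPrimitive F m (k / 2)
      else (dyadicPrimitive F m (k / 2) + dyadicPrimitive F m (k / 2 + 1) +
        F (k / 2 ^ (m + 1)) ((k / 2 : ℕ) / 2 ^ m) -
        F (((k / 2 : ℕ) + 1) / 2 ^ m) (k / 2 ^ (m + 1))) / 2

lemma dyadicPrimitive_even (F : ℝ → ℝ → ℝ) (m k : ℕ) :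
    dyadicPrimitive F (m + 1) (2 * k) = dyadicPrimitive F m k := by
  simp [dyadicPrimitive]

lemma dyadicPrimitive_odd (F : ℝ → ℝ → ℝ) (m k : ℕ) :
    dyadicPrimitive F (m + 1) (2 * k + 1) =
      (dyadicPrimitive F m k + dyadicPrimitive F m (k + 1) +
        F ((2 * k + 1) / 2 ^ (m + 1)) (k / 2 ^ m) -
        F ((k + 1) / 2 ^ m) ((2 * k + 1) / 2 ^ (m + 1))) / 2 := by
  have h1 : (2 * k + 1) / 2 = k := by omega
  have h2 : (2 * k + 1) % 2 ≠ 0 := by omega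
  rw [dyadicPrimitive, if_neg h2, h1]
  push_cast
  rfl

variable {γ C : ℝ} {F : ℝ → ℝ → ℝ}

lemma half_lt_half_rpow (hγ : γ < 1) : (1 / 2 : ℝ) < (1 / 2) ^ γ := by
  simpa using Real.rpow_lt_rpow_of_exponent_gt (x := 1 / 2) (by norm_num) (by norm_num) hγ

lemma inv_two_pow_rpow (m : ℕ) : (1 / 2 ^ m : ℝ) ^ γ = ((1 / 2) ^ γ) ^ m := by
  rw [← one_div_pow, ← Real.rpow_natCast, ← Real.rpow_mul (by norm_num), mul_comm,
    Real.rpow_mul (by norm_num), Real.rpow_natCast]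

lemma abs_sub_sub_le_of_dyadic (hγ0 : 0 < γ) (hγ : γ < 1) (hC : 0 ≤ C)
    (hF : ∀ t ∈ Set.Icc (0 : ℝ) 1, ∀ u ∈ Set.Icc (0 : ℝ) 1, ∀ s ∈ Set.Icc (0 : ℝ) 1,
      |F t s - F t u - F u s| ≤ C * (|t - u| + |u - s|) ^ γ)
    {t u s : ℝ} (ht : t ∈ Set.Icc (0 : ℝ) 1) (hu : u ∈ Set.Icc (0 : ℝ) 1)
    (hs : s ∈ Set.Icc (0 : ℝ) 1) (m : ℕ) (h : |t - u| + |u - s| ≤ 4 * (1 / 2 ^ m)) :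
    |F t s - F t u - F u s| ≤ 4 * C * ((1 / 2) ^ γ) ^ m := by
  refine (hF t ht u hu s hs).trans ?_
  rw [← inv_two_pow_rpow, mul_comm (4 : ℝ), mul_assoc]
  refine mul_le_mul_of_nonneg_left ?_ hC
  calc (|t - u| + |u - s|) ^ γ ≤ (4 * (1 / 2 ^ m)) ^ γ := by gcongr
    _ = 4 ^ γ * (1 / 2 ^ m) ^ γ := Real.mul_rpow (by norm_num) (by positivity)
    _ ≤ 4 * (1 / 2 ^ m) ^ γ := by
      gcongr
      simpa using Real.rpow_le_rpow_of_exponent_le (x := 4) (by norm_num) hγ.le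

lemma exists_dyadicPrimitive_bound (hγ0 : 0 < γ) (hγ : γ < 1) (hC : 0 ≤ C)
    (hF : ∀ t ∈ Set.Icc (0 : ℝ) 1, ∀ u ∈ Set.Icc (0 : ℝ) 1, ∀ s ∈ Set.Icc (0 : ℝ) 1,
      |F t s - F t u - F u s| ≤ C * (|t - u| + |u - s|) ^ γ) :
    ∃ K, 0 ≤ K ∧ ∀ m k : ℕ, k + 1 ≤ 2 ^ m →
      |F ((k + 1) / 2 ^ m) (k / 2 ^ m) - dyadicPrimitive F m (k + 1) + dyadicPrimitive F m k| ≤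
        K * ((1 / 2) ^ γ) ^ m := by
  set ρ : ℝ := (1 / 2) ^ γ with hρ
  have hρ2 : 0 < ρ - 1 / 2 := sub_pos.mpr (half_lt_half_rpow hγ)
  have hρ0 : 0 < ρ := by linarith
  set K : ℝ := max |F 1 0| (4 * C / (2 * (ρ - 1 / 2))) with hK
  have hK1 : K + 4 * C ≤ 2 * (K * ρ) := by
    have := le_max_right |F 1 0| (4 * C / (2 * (ρ - 1 / 2)))
    rw [← hK, div_le_iff₀ (by linarith)] at this
    linarith
  refine ⟨K, (abs_nonneg _).trans (le_max_left _ _), fun m => ?_⟩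
  induction m with
  | zero =>
    intro k hk
    obtain rfl : k = 0 := by simpa using hk
    simp [dyadicPrimitive, hK]
  | succ m ih =>
    intro k hk
    have hpow : (0 : ℝ) < 2 ^ m := by positivity
    obtain ⟨l, hl⟩ : ∃ l, k = 2 * l ∨ k = 2 * l + 1 := ⟨k / 2, by omega⟩
    have hl' : l + 1 ≤ 2 ^ m := by rw [pow_succ] at hk; omega
    have hlr : (l : ℝ) + 1 ≤ 2 ^ m := by exact_mod_cast hl'
    have hl0 : (0 : ℝ) ≤ l := l.cast_nonneg
    have ihl := ih l hl'
    set s : ℝ := l / 2 ^ m with hs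
    set t : ℝ := (l + 1) / 2 ^ m with ht
    set u : ℝ := (2 * l + 1) / 2 ^ (m + 1) with hu
    have hts : t - s = 1 / 2 ^ m := by rw [ht, hs]; field_simp; ring
    have hus : u = (t + s) / 2 := by rw [ht, hs, hu]; field_simp; ring
    have hs0 : 0 ≤ s := by positivity
    have ht1 : t ≤ 1 := by rw [ht, div_le_one hpow]; exact hlr
    have hd : 0 < 1 / (2 : ℝ) ^ m := by positivity
    have hδ := abs_sub_sub_le_of_dyadic hγ0 hγ hC hF (t := t) (u := u) (s := s)
      ⟨by linarith, ht1⟩ ⟨by linarith, by linarith⟩ ⟨hs0, by linarith⟩ m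
      (by rw [abs_of_nonneg (by linarith), abs_of_nonneg (by linarith)]; linarith)
    have hstep : K * ρ ^ m + 4 * C * ρ ^ m ≤ 2 * (K * ρ ^ (m + 1)) := by
      have := mul_le_mul_of_nonneg_right hK1 (pow_nonneg hρ0.le m)
      rw [pow_succ]
      linarith
    have hodd := dyadicPrimitive_odd F m l
    rw [← hs, ← ht, ← hu] at hodd
    rw [abs_le] at ihl hδ ⊢
    obtain rfl | rfl := hl
    · have e1 : (((2 * l : ℕ) : ℝ) + 1) / 2 ^ (m + 1) = u := by push_cast; rfl
      have e2 : ((2 * l : ℕ) : ℝ) / 2 ^ (m + 1) = s := by rw [hs, pow_succ]; push_cast; field_simp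
      rw [e1, e2, hodd, dyadicPrimitive_even]
      constructor <;> linarith
    · have e1 : (((2 * l + 1 : ℕ) : ℝ) + 1) / 2 ^ (m + 1) = t := by
        rw [ht, pow_succ]; push_cast; field_simp; ring
      have e2 : ((2 * l + 1 : ℕ) : ℝ) / 2 ^ (m + 1) = u := by rw [hu]; push_cast; rfl
      rw [e1, e2, hodd, show 2 * l + 1 + 1 = 2 * (l + 1) by ring, dyadicPrimitive_even]
      constructor <;> linarith

lemma floor_two_pow_mul_div {t : ℝ} (ht : 0 ≤ t) (m : ℕ) :
    0 ≤ t - ⌊2 ^ m * t⌋₊ / 2 ^ m ∧ t - ⌊2 ^ m * t⌋₊ / 2 ^ m ≤ 1 / 2 ^ m := by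
  have hpow : (0 : ℝ) < 2 ^ m := by positivity
  have h1 := Nat.floor_le (a := 2 ^ m * t) (by positivity)
  have h2 := (Nat.lt_floor_add_one (2 ^ m * t)).le
  constructor
  · rw [sub_nonneg, div_le_iff₀ hpow]
    linarith
  · rw [sub_le_iff_le_add, ← add_div, le_div_iff₀ hpow]
    linarith

lemma floor_two_pow_succ_mul (t : ℝ) (m : ℕ) :
    ⌊2 ^ (m + 1) * t⌋₊ = 2 * ⌊2 ^ m * t⌋₊ ∨ ⌊2 ^ (m + 1) * t⌋₊ = 2 * ⌊2 ^ m * t⌋₊ + 1 := by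
  have h : (⌊2 ^ (m + 1) * t⌋₊) / 2 = ⌊2 ^ m * t⌋₊ := by
    rw [← Nat.floor_div_ofNat]
    congr 1
    rw [pow_succ]
    ring
  omega

/-- A two-parameter function on the unit interval that is additive up to an error of order
`γ < 1` is the increment of a one-parameter function up to an error of order `γ`. -/
theorem exists_approx_primitive (hγ0 : 0 < γ) (hγ : γ < 1)
    (hF : ∀ t ∈ Set.Icc (0 : ℝ) 1, ∀ u ∈ Set.Icc (0 : ℝ) 1, ∀ s ∈ Set.Icc (0 : ℝ) 1,
      |F t s - F t u - F u s| ≤ C * (|t - u| + |u - s|) ^ γ) :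
    ∃ g : ℝ → ℝ, ∃ K, ∀ t ∈ Set.Icc (0 : ℝ) 1, ∀ s ∈ Set.Icc (0 : ℝ) 1,
      |F t s - (g t - g s)| ≤ K * |t - s| ^ γ := by
  have hC : 0 ≤ C := by
    have := (abs_nonneg _).trans (hF 1 (by simp) 0 (by simp) 0 (by simp))
    simpa using this
  obtain ⟨K, hK0, hK⟩ := exists_dyadicPrimitive_bound hγ0 hγ hC hF
  set ρ : ℝ := (1 / 2) ^ γ with hρ
  have hρ0 : 0 < ρ := by positivity
  have hρ1 : ρ < 1 := Real.rpow_lt_one (by norm_num) (by norm_num) hγ0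
  set k : ℕ → ℝ → ℕ := fun m t => ⌊2 ^ m * t⌋₊ with hk
  set π : ℕ → ℝ → ℝ := fun m t => k m t / 2 ^ m with hπ
  have hδ := fun {t u s : ℝ} => abs_sub_sub_le_of_dyadic (t := t) (u := u) (s := s) hγ0 hγ hC hF
  rw [← hρ] at hδ
  have hπI : ∀ m, ∀ t ∈ Set.Icc (0 : ℝ) 1, π m t ∈ Set.Icc (0 : ℝ) 1 := fun m t ht =>
    ⟨by positivity, by linarith [(floor_two_pow_mul_div ht.1 m).1, ht.2]⟩
  have hdist : ∀ m, ∀ t ∈ Set.Icc (0 : ℝ) 1, |t - π m t| ≤ 1 / 2 ^ m := fun m t ht => by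
    rw [abs_of_nonneg (floor_two_pow_mul_div ht.1 m).1]
    exact (floor_two_pow_mul_div ht.1 m).2
  set a : ℝ → ℕ → ℝ := fun t m => dyadicPrimitive F m (k m t) + F t (π m t) with ha
  have hself : ∀ t ∈ Set.Icc (0 : ℝ) 1, F t t = 0 := fun t ht => by
    have := hF t ht t ht t ht
    simpa [Real.zero_rpow hγ0.ne'] using this
  have hstep : ∀ t ∈ Set.Icc (0 : ℝ) 1, ∀ m, dist (a t m) (a t (m + 1)) ≤ (K + 4 * C) * ρ ^ m := by
    intro t ht m
    have hm1 : (1 : ℝ) / 2 ^ (m + 1) ≤ 1 / 2 ^ m := by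
      gcongr <;> norm_num
    have h1 := hδ ht (hπI (m + 1) t ht) (hπI m t ht) m (by
      have h1 := hdist m t ht
      have h2 := hdist (m + 1) t ht
      have h3 := abs_sub_le (π (m + 1) t) t (π m t)
      rw [abs_sub_comm _ t] at h3
      have : 0 < 1 / (2 : ℝ) ^ m := by positivity
      linarith)
    have h2 : |F (π (m + 1) t) (π m t) - dyadicPrimitive F (m + 1) (k (m + 1) t) +
        dyadicPrimitive F m (k m t)| ≤ K * ρ ^ m := by
      obtain h | h := floor_two_pow_succ_mul t m
      · have e : π (m + 1) t = π m t := by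
          simp only [hπ, hk, h]
          rw [pow_succ]
          push_cast
          field_simp
        rw [e, hself _ (hπI m t ht)]
        simp only [hk, h, dyadicPrimitive_even]
        simp
        positivity
      · have hle : k (m + 1) t ≤ 2 ^ (m + 1) := by
          have := (hπI (m + 1) t ht).2
          rw [div_le_one (by positivity)] at this
          exact_mod_cast this
        have h3 := hK (m + 1) (2 * k m t) (by simp only [hk, h] at hle ⊢; exact hle)
        rw [dyadicPrimitive_even] at h3
        have e1 : (((2 * k m t : ℕ) : ℝ) + 1) / 2 ^ (m + 1) = π (m + 1) t := by
          simp only [hπ, hk, h]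
          push_cast
          rfl
        have e2 : ((2 * k m t : ℕ) : ℝ) / 2 ^ (m + 1) = π m t := by
          simp only [hπ, pow_succ]
          push_cast
          field_simp
        have e3 : k (m + 1) t = 2 * k m t + 1 := h
        rw [e1, e2, ← e3] at h3
        refine h3.trans (mul_le_mul_of_nonneg_left ?_ hK0)
        exact pow_le_pow_of_le_one hρ0.le hρ1.le (Nat.le_succ m)
    rw [Real.dist_eq]
    rw [abs_le] at h1 h2 ⊢
    simp only [ha]
    constructor <;> linarith
  have hlim : ∀ t ∈ Set.Icc (0 : ℝ) 1, ∃ l, Tendsto (a t) atTop (𝓝 l) := fun t ht =>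
    cauchySeq_tendsto_of_complete (cauchySeq_of_le_geometric ρ _ hρ1 (hstep t ht))
  choose! g hg using hlim
  set M : ℝ := (K + 4 * C) / (1 - ρ) with hM
  have hgm : ∀ t ∈ Set.Icc (0 : ℝ) 1, ∀ m, |a t m - g t| ≤ M * ρ ^ m := fun t ht m => by
    have := dist_le_of_le_geometric_of_tendsto ρ _ hρ1 (hstep t ht) (hg t ht) m
    rw [Real.dist_eq] at this
    rwa [hM, div_mul_eq_mul_div]
  have hM0 : 0 ≤ M := div_nonneg (by positivity) (by linarith)
  set L : ℝ := 2 * (K + 2 * M + 12 * C) with hL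
  have hL0 : 0 ≤ L := by positivity
  have hlt : ∀ t ∈ Set.Icc (0 : ℝ) 1, ∀ s ∈ Set.Icc (0 : ℝ) 1, s < t →
      |F t s - (g t - g s)| ≤ L * |t - s| ^ γ := by
    intro t ht s hs hst
    obtain ⟨m, hm1, hm2⟩ := exists_nat_pow_near_of_lt_one (x := t - s) (y := 1 / 2) (by linarith)
      (by linarith [ht.2, hs.1]) (by norm_num) (by norm_num)
    rw [one_div_pow] at hm1 hm2
    have hd : 0 < 1 / (2 : ℝ) ^ m := by positivity
    have hpow : (0 : ℝ) < 2 ^ m := by positivity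
    have hρm : ρ ^ m ≤ 2 * |t - s| ^ γ := by
      rw [hρ, ← inv_two_pow_rpow]
      calc (1 / 2 ^ m : ℝ) ^ γ ≤ (2 * |t - s|) ^ γ := by
            rw [abs_of_pos (by linarith)]
            gcongr
            rw [pow_succ, ← div_div] at hm1
            linarith
        _ = 2 ^ γ * |t - s| ^ γ := Real.mul_rpow (by norm_num) (by positivity)
        _ ≤ 2 * |t - s| ^ γ := by
          gcongr
          simpa using Real.rpow_le_rpow_of_exponent_le (x := 2) (by norm_num) hγ.le
    have hts : |t - s| ≤ 1 / 2 ^ m := by rwa [abs_of_pos (by linarith)]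
    have d1 := hdist m t ht
    have d2 := hdist m s hs
    have d1' := abs_sub_comm (π m t) t
    have d2' := abs_sub_comm (π m s) s
    have d3 := abs_sub_le (π m t) t s
    have d4 := abs_sub_le (π m t) s (π m s)
    have h1 := hδ ht (hπI m t ht) hs m (by linarith)
    have h2 := hδ (hπI m t ht) (hπI m s hs) hs m (by linarith)
    have h3 := hδ hs (hπI m s hs) hs m (by linarith)
    have h4 := hgm t ht m
    have h5 := hgm s hs m
    have h6 : |F (π m t) (π m s) - dyadicPrimitive F m (k m t) + dyadicPrimitive F m (k m s)| ≤
        K * ρ ^ m := by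
      have hk1 : k m s ≤ k m t := Nat.floor_mono (by gcongr)
      have hk2 : k m t ≤ k m s + 1 := by
        simp only [hk]
        rw [← Nat.floor_add_one (by have := hs.1; positivity)]
        refine Nat.floor_mono ?_
        rw [le_div_iff₀ hpow] at hm2
        linarith
      obtain h | h : k m t = k m s ∨ k m t = k m s + 1 := by omega
      · have e : π m t = π m s := by simp only [hπ, h]
        rw [e, h, hself _ (hπI m s hs)]
        simp
        positivity
      · have hle : k m t ≤ 2 ^ m := by
          have := (hπI m t ht).2
          rw [div_le_one hpow] at this
          exact_mod_cast this
        have e : π m t = (k m s + 1) / 2 ^ m := by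
          simp only [hπ, h]
          push_cast
          rfl
        rw [e, h]
        exact hK m (k m s) (h ▸ hle)
    rw [hself s hs] at h3
    have hfin : |F t s - (g t - g s)| ≤ (K + 2 * M + 12 * C) * ρ ^ m := by
      simp only [ha] at h4 h5
      rw [abs_le] at h1 h2 h3 h4 h5 h6 ⊢
      constructor <;> linarith
    refine hfin.trans ?_
    rw [hL, mul_comm 2 (K + 2 * M + 12 * C), mul_assoc]
    exact mul_le_mul_of_nonneg_left hρm (by positivity)
  refine ⟨g, L + 2 * C, fun t ht s hs => ?_⟩
  obtain h | rfl | h := lt_trichotomy s t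
  · refine (hlt t ht s hs h).trans ?_
    gcongr
    linarith
  · simp [hself _ ht, Real.zero_rpow hγ0.ne']
  · have h1 := hlt s hs t ht h
    have h2 := hF t ht s hs t ht
    rw [hself t ht, abs_sub_comm s t, ← two_mul, Real.mul_rpow (by norm_num) (by positivity)] at h2
    rw [abs_sub_comm s t] at h1
    have h3 : (2 : ℝ) ^ γ ≤ 2 := by
      simpa using Real.rpow_le_rpow_of_exponent_le (x := 2) (by norm_num) hγ.le
    have h4 : C * (2 ^ γ * |t - s| ^ γ) ≤ C * (2 * |t - s| ^ γ) := by gcongr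
    rw [abs_le] at h1 h2 ⊢
    constructor <;> linarith

end DyadicPrimitive

section RoughPath

/-- `f` is bounded by a multiple of `|t - s| ^ γ` on the unit interval. -/
def HolderBound (γ : ℝ) (f : ℝ → ℝ → ℝ) : Prop :=
  ∃ C, ∀ t ∈ Set.Icc (0 : ℝ) 1, ∀ s ∈ Set.Icc (0 : ℝ) 1, |f t s| ≤ C * |t - s| ^ γ

variable {γ : ℝ}

lemma HolderBound.add {f g : ℝ → ℝ → ℝ} (hf : HolderBound γ f) (hg : HolderBound γ g) :
    HolderBound γ fun t s => f t s + g t s := by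
  obtain ⟨C, hC⟩ := hf
  obtain ⟨D, hD⟩ := hg
  refine ⟨C + D, fun t ht s hs => ?_⟩
  rw [add_mul]
  exact (abs_add_le _ _).trans (add_le_add (hC t ht s hs) (hD t ht s hs))

lemma holderBound_zero : HolderBound γ fun _ _ => 0 := ⟨0, by simp⟩

lemma HolderBound.mul_const {f : ℝ → ℝ → ℝ} (hf : HolderBound γ f) (c : ℝ) :
    HolderBound γ fun t s => f t s * c := by
  obtain ⟨C, hC⟩ := hf
  refine ⟨C * |c|, fun t ht s hs => ?_⟩
  rw [abs_mul, mul_right_comm]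
  exact mul_le_mul_of_nonneg_right (hC t ht s hs) (abs_nonneg c)

lemma HolderBound.mul {γ' : ℝ} {f g : ℝ → ℝ → ℝ} (hγ : 0 ≤ γ) (hγ' : 0 ≤ γ')
    (hf : HolderBound γ f) (hg : HolderBound γ' g) :
    HolderBound (γ + γ') fun t s => f t s * g t s := by
  obtain ⟨C, hC⟩ := hf
  obtain ⟨D, hD⟩ := hg
  refine ⟨C * D, fun t ht s hs => ?_⟩
  rw [abs_mul, Real.rpow_add_of_nonneg (abs_nonneg _) hγ hγ', mul_mul_mul_comm]
  exact mul_le_mul (hC t ht s hs) (hD t ht s hs) (abs_nonneg _)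
    ((abs_nonneg _).trans (hC t ht s hs))

lemma HolderBound.sum {ι : Type*} (I : Finset ι) {f : ι → ℝ → ℝ → ℝ}
    (hf : ∀ i, HolderBound γ (f i)) : HolderBound γ fun t s => ∑ i ∈ I, f i t s := by
  classical
  induction I using Finset.induction_on with
  | empty => simpa using holderBound_zero
  | insert i I hi ih =>
    simp only [Finset.sum_insert hi]
    exact (hf i).add ih

lemma HolderBound.linearMap {ι κ : Type*} [Fintype ι] (L : (ι → ℝ) →ₗ[ℝ] (κ → ℝ))
    {f : ι → ℝ → ℝ → ℝ} (hf : ∀ i, HolderBound γ (f i)) (k : κ) :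
    HolderBound γ fun t s => L (fun i => f i t s) k := by
  classical
  have : ∀ t s, L (fun i => f i t s) k = ∑ i, f i t s * L (fun j => if i = j then 1 else 0) k := by
    intro t s
    rw [LinearMap.pi_apply_eq_sum_univ L]
    simp
  simp only [this]
  exact HolderBound.sum _ fun i => (hf i).mul_const _

/-- Every linear map over a field has a generalized inverse. -/
lemma LinearMap.exists_generalizedInverse {K V W : Type*} [Field K] [AddCommGroup V] [Module K V]
    [AddCommGroup W] [Module K W] (T : V →ₗ[K] W) : ∃ S : W →ₗ[K] V, ∀ x, T (S (T x)) = T x := by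
  obtain ⟨σ, hσ⟩ := T.rangeRestrict.exists_rightInverse_of_surjective T.range_rangeRestrict
  obtain ⟨S, hS⟩ := LinearMap.exists_extend σ
  refine ⟨S, fun x => ?_⟩
  have h1 : S (T x) = σ (T.rangeRestrict x) := by
    rw [← hS]
    rfl
  have h2 := congrArg Subtype.val (LinearMap.congr_fun hσ (T.rangeRestrict x))
  rw [h1]
  exact h2

variable {A : Type*}

/-- Extension by zero of a function on words of length `m`. -/
def extendWord (m : ℕ) (e : List.Vector A m → ℝ) (w : List A) : ℝ :=
  if h : w.length = m then e ⟨w, h⟩ else 0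

/-- Pairing of functions on words of length `m` with the shuffles of two nonempty words, indexed by
the length of the first word and the concatenation of both. -/
def shufflePairing (A : Type*) (m : ℕ) :
    (List.Vector A m → ℝ) →ₗ[ℝ] (Fin m × List.Vector A m → ℝ) where
  toFun e p := if (p.1 : ℕ) = 0 then 0 else
    shuffleEval (extendWord m e) (p.2.1.take p.1) (p.2.1.drop p.1)
  map_add' e f := by
    funext p
    have h : extendWord m (e + f) = fun w => extendWord m e w + extendWord m f w := by
      funext w
      unfold extendWord
      split_ifs
      · rfl
      · simp
    simp only [Pi.add_apply, h, shuffleEval_add]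
    split_ifs <;> simp
  map_smul' c e := by
    funext p
    have h : extendWord m (c • e) = fun w => c * extendWord m e w := by
      funext w
      unfold extendWord
      split_ifs
      · rfl
      · simp
    simp [h, shuffleEval_const_mul]

lemma shuffleEval_extendWord {m : ℕ} (e : List.Vector A m → ℝ) {u v : List A} (hu : u ≠ [])
    (hv : v ≠ []) (h : u.length + v.length = m) :
    shuffleEval (extendWord m e) u v = shufflePairing A m e
      (⟨u.length, by have := List.length_pos_iff.mpr hv; omega⟩, ⟨u ++ v, by simp [h]⟩) := by
  simp [shufflePairing, hu]

lemma rpow_mul_rpow_le_add {a b x y : ℝ} (ha : 0 ≤ a) (hb : 0 ≤ b) (hx : 0 ≤ x) (hy : 0 ≤ y) :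
    x ^ a * y ^ b ≤ (x + y) ^ (a + b) := by
  rw [Real.rpow_add_of_nonneg (by positivity) ha hb]
  gcongr <;> linarith

variable {α : ℝ} {Y : ℝ → List A → ℝ}

/-- By Chen's relation, the top level is additive up to an error controlled by lower levels. -/
lemma exists_chen_defect_bound (hα : 0 ≤ α) {w : List A} (hw : w ≠ [])
    (hY : ∀ t, IsGroupLike (Y t))
    (hH : ∀ v : List A, v.length < w.length →
      HolderBound (v.length * α) fun t s => conv (Y t) (convInv (Y s)) v) :
    ∃ C, ∀ t ∈ Set.Icc (0 : ℝ) 1, ∀ u ∈ Set.Icc (0 : ℝ) 1, ∀ s ∈ Set.Icc (0 : ℝ) 1,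
      |conv (Y t) (convInv (Y s)) w - conv (Y t) (convInv (Y u)) w -
        conv (Y u) (convInv (Y s)) w| ≤ C * (|t - u| + |u - s|) ^ (w.length * α) := by
  choose! C hC using hH
  obtain ⟨m, hm⟩ : ∃ m, w.length = m + 1 :=
    Nat.exists_eq_succ_of_ne_zero (by simpa using hw)
  refine ⟨∑ k ∈ Finset.range m, |C (w.take (k + 1))| * |C (w.drop (k + 1))|,
    fun t ht u hu s hs => ?_⟩
  have h1 : conv (Y t) (convInv (Y s)) w - conv (Y t) (convInv (Y u)) w -
      conv (Y u) (convInv (Y s)) w = ∑ k ∈ Finset.range m,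
        conv (Y t) (convInv (Y u)) (w.take (k + 1)) *
          conv (Y u) (convInv (Y s)) (w.drop (k + 1)) := by
    conv_lhs => rw [← conv_conv_convInv (a := Y t) (b := Y u) (c := Y s) (hY u).1]
    have e1 : w.take (m + 1) = w := by rw [← hm, List.take_length]
    have e2 : w.drop (m + 1) = [] := by rw [← hm, List.drop_length]
    rw [_root_.conv, hm, Finset.sum_range_succ, Finset.sum_range_succ', e1, e2]
    simp [(hY _).1]
  rw [h1, Finset.sum_mul]
  refine (Finset.abs_sum_le_sum_abs _ _).trans (Finset.sum_le_sum fun k hk => ?_)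
  rw [Finset.mem_range] at hk
  have l1 : (w.take (k + 1)).length = k + 1 := by simp; omega
  have l2 : (w.drop (k + 1)).length = m - k := by simp; omega
  have b1 := (hC (w.take (k + 1)) (by omega) t ht u hu).trans
    (mul_le_mul_of_nonneg_right (le_abs_self _) (by positivity))
  have b2 := (hC (w.drop (k + 1)) (by omega) u hu s hs).trans
    (mul_le_mul_of_nonneg_right (le_abs_self _) (by positivity))
  have hsum : (w.length : ℝ) * α =
      (w.take (k + 1)).length * α + (w.drop (k + 1)).length * α := by
    rw [← add_mul, ← Nat.cast_add, ← List.length_append, List.take_append_drop]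
  rw [abs_mul, hsum]
  refine (mul_le_mul b1 b2 (abs_nonneg _) (by positivity)).trans ?_
  rw [mul_mul_mul_comm]
  gcongr
  exact rpow_mul_rpow_le_add (by positivity) (by positivity) (abs_nonneg _) (abs_nonneg _)

/-- Extension of the Hölder bounds to degree `m` by a perturbation in degree `m`. -/
lemma exists_holder_extension (hα : 0 < α) {m : ℕ} (hm : 1 ≤ m) (hm1 : m * α < 1) [Finite A]
    (hY : ∀ t, IsGroupLike (Y t))
    (hH : ∀ v : List A, v.length < m →
      HolderBound (v.length * α) fun t s => conv (Y t) (convInv (Y s)) v) :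
    ∃ Y' : ℝ → List A → ℝ, (∀ t, IsGroupLike (Y' t)) ∧
      (∀ v : List A, v.length < m → ∀ t s,
        conv (Y' t) (convInv (Y' s)) v = conv (Y t) (convInv (Y s)) v) ∧
      ∀ v : List A, v.length = m →
        HolderBound (m * α) fun t s => conv (Y' t) (convInv (Y' s)) v := by
  have := Fintype.ofFinite A
  have hmα : 0 < m * α := by positivity
  have hg : ∀ w : List.Vector A m, ∃ g : ℝ → ℝ,
      HolderBound (m * α) fun t s => conv (Y t) (convInv (Y s)) w.1 - (g t - g s) := by
    rintro ⟨w, hw⟩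
    obtain ⟨C, hC⟩ := exists_chen_defect_bound (w := w) hα.le (by rintro rfl; simp at hw; omega) hY
      fun v hv => hH v (hw ▸ hv)
    rw [hw] at hC
    exact exists_approx_primitive hmα hm1 hC
  choose g hg using hg
  set T := shufflePairing A m with hT
  obtain ⟨S, hS⟩ := LinearMap.exists_generalizedInverse T
  set z : ℝ → List.Vector A m → ℝ := fun t => S (T fun w => g w t) - fun w => g w t with hz
  have hTz : ∀ t, T (z t) = 0 := fun t => by rw [hz, map_sub, hS, sub_self]
  have hzsh : ∀ t u v, u ≠ [] → v ≠ [] → u.length + v.length = m →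
      shuffleEval (extendWord m (z t)) u v = 0 := fun t u v hu hv h => by
    rw [shuffleEval_extendWord _ hu hv h, ← hT, hTz]
    rfl
  choose e he hez using fun t => exists_isGroupLike_of_homogeneous hm _ (hzsh t)
  have hY' : ∀ t w, w.length ≤ m →
      conv (Y t) (e t) w = Y t w + if w.length = m then extendWord m (z t) w else 0 :=
    fun t w hw => by rw [conv_perturb_right (hY t).1 (hez t) hw, conv_convOne]
  have hX : ∀ t s w, w.length ≤ m →
      conv (conv (Y t) (e t)) (convInv (conv (Y s) (e s))) w = conv (Y t) (convInv (Y s)) w +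
        if w.length = m then extendWord m (z t) w - extendWord m (z s) w else 0 :=
    fun t s w hw => conv_convInv_perturb (hY t).1 (hY s).1 ((hY s).conv (he s)).1
      (hY' t) (hY' s) hw
  refine ⟨fun t => conv (Y t) (e t), fun t => (hY t).conv (he t), fun v hv t s => ?_,
    fun v hv => ?_⟩
  · rw [hX t s v hv.le, if_neg hv.ne, add_zero]
  have hpair : ∀ p, HolderBound (m * α) fun t s =>
      T (fun w => conv (Y t) (convInv (Y s)) w.1) p := by
    rintro ⟨k, w, hw⟩
    by_cases hk : (k : ℕ) = 0
    · simpa [hT, shufflePairing, hk] using holderBound_zero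
    have l1 : (w.take k).length = k := by simp [hw]
    have l2 : (w.drop k).length = m - k := by simp [hw]
    have hmul := (hH (w.take k) (by omega)).mul (by positivity) (by positivity)
      (hH (w.drop k) (by omega))
    rw [← add_mul, ← Nat.cast_add, ← List.length_append, List.take_append_drop, hw] at hmul
    convert hmul using 3 with t s
    rw [← ((hY t).conv (hY s).convInv).2]
    simp only [hT, shufflePairing, LinearMap.coe_mk, AddHom.coe_mk, if_neg hk]
    refine shuffleEval_congr fun x hx => ?_
    rw [extendWord, dif_pos]
    rw [hx, ← List.length_append, List.take_append_drop, hw]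
  have h1 := hg ⟨v, hv⟩
  have h2 := (HolderBound.linearMap (S ∘ₗ T) hg ⟨v, hv⟩).mul_const (-1)
  have h3 := HolderBound.linearMap S hpair ⟨v, hv⟩
  convert (h1.add h2).add h3 using 3 with t s
  have hlin : (S ∘ₗ T) (fun w => conv (Y t) (convInv (Y s)) w.1 - (g w t - g w s)) =
      S (T fun w => conv (Y t) (convInv (Y s)) w.1) -
        (S (T fun w => g w t) - S (T fun w => g w s)) := by
    rw [← map_sub, ← map_sub, ← map_sub, ← map_sub]
    rfl
  have hext : ∀ t, extendWord m (z t) v = z t ⟨v, hv⟩ := fun t => dif_pos hv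
  have hzv : ∀ t, z t ⟨v, hv⟩ = S (T fun w => g w t) ⟨v, hv⟩ - g ⟨v, hv⟩ t := fun _ => rfl
  have hlinv : (S ∘ₗ T) (fun w => conv (Y t) (convInv (Y s)) w.1 - (g w t - g w s)) ⟨v, hv⟩ =
      S (T fun w => conv (Y t) (convInv (Y s)) w.1) ⟨v, hv⟩ -
        (S (T fun w => g w t) ⟨v, hv⟩ - S (T fun w => g w s) ⟨v, hv⟩) := congrFun hlin _
  rw [hX t s v hv.le, if_pos hv, hext, hext, hzv, hzv, hlinv]
  ring

/-- An `α`-Hölder path on the unit interval lifts to a path of group-like series whose increments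
are Hölder continuous up to any degree `n` with `n * α < 1`. -/
theorem exists_groupLike_lift (hα : 0 < α) [Finite A] (Γ : ℝ → A → ℝ)
    (hΓ : ∀ i, HolderBound α fun t s => Γ t i - Γ s i) {n : ℕ} (hn : 1 ≤ n) (hn1 : n * α < 1) :
    ∃ Y : ℝ → List A → ℝ, (∀ t, IsGroupLike (Y t)) ∧
      (∀ i t s, conv (Y t) (convInv (Y s)) [i] = Γ t i - Γ s i) ∧
      ∀ w : List A, w.length ≤ n →
        HolderBound (w.length * α) fun t s => conv (Y t) (convInv (Y s)) w := by
  induction n, hn using Nat.le_induction with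
  | base =>
    set z : ℝ → List A → ℝ := fun t w => (w.head?.map (Γ t)).getD 0 with hz
    choose e he hez using fun t => exists_isGroupLike_of_homogeneous le_rfl (z t)
      fun u v hu hv h => by
        have h1 := List.length_pos_iff.mpr hu
        have h2 := List.length_pos_iff.mpr hv
        omega
    have hinc : ∀ i t s, conv (e t) (convInv (e s)) [i] = Γ t i - Γ s i := fun i t s => by
      rw [conv_convInv_perturb (a := convOne) (b := convOne) rfl rfl (he s).1 (hez t) (hez s)
        (by simp), conv_convInv rfl]
      simp [convOne, hz]
    refine ⟨e, he, hinc, fun w hw => ?_⟩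
    obtain _ | ⟨i, _ | ⟨j, w⟩⟩ := w
    · exact ⟨1, fun t _ s _ => by simp [(he t).1]⟩
    · simpa [hinc] using hΓ i
    · simp at hw
  | succ n hn ih =>
    obtain ⟨Y, hY, hinc, hH⟩ := ih (by push_cast at hn1; linarith)
    obtain ⟨Y', hY', hlow, htop⟩ := exists_holder_extension hα (by omega) hn1 hY
      fun v hv => hH v (by omega)
    refine ⟨Y', hY', fun i t s => ?_, fun w hw => ?_⟩
    · rw [hlow _ (by simp; omega), hinc]
    · obtain h | h := hw.lt_or_eq
      · simp only [hlow w h]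
        exact hH w (by omega)
      · rw [h]
        exact htop w h

lemma conv_ofFn {d n : ℕ} (a b : List (Fin d) → ℝ) (w : Fin n → Fin d) (hn : 1 ≤ n) :
    conv a b (List.ofFn w) = a (List.ofFn w) * b [] + a [] * b (List.ofFn w) +
      ∑ k ∈ Finset.univ.filter (fun k : Fin n => 0 < k.1),
        a (List.ofFn fun j : Fin k.1 => w ⟨j.1, j.isLt.trans k.isLt⟩) *
          b (List.ofFn fun j : Fin (n - k.1) => w ⟨k.1 + j.1, by omega⟩) := by
  have h1 : ∀ k : Fin n, (List.ofFn fun j : Fin k.1 => w ⟨j.1, j.isLt.trans k.isLt⟩) =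
      (List.ofFn w).take k := fun k => List.ext_getElem (by simp) (by simp)
  have h2 : ∀ k : Fin n, (List.ofFn fun j : Fin (n - k.1) => w ⟨k.1 + j.1, by omega⟩) =
      (List.ofFn w).drop k := fun k => List.ext_getElem (by simp) (by simp)
  simp only [h1, h2]
  obtain ⟨n, rfl⟩ := Nat.exists_eq_add_of_le' hn
  have e1 : (List.ofFn w).take (n + 1) = List.ofFn w := List.take_of_length_le (by simp)
  have e2 : (List.ofFn w).drop (n + 1) = [] := List.drop_of_length_le (by simp)
  rw [conv, List.length_ofFn, Finset.sum_range_succ, e1, e2, Finset.sum_range, Finset.sum_filter,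
    Fin.sum_univ_succ, Fin.sum_univ_succ]
  simp
  ring

end RoughPath

/-- **Main theorem**: existence of an α-Hölder geometric rough path over any compactly
supported α-Hölder path, `1/α ∉ ℕ`, `N = ⌊1/α⌋`. -/
theorem exists_geometric_rough_path
    (α : ℝ) (hα0 : 0 < α) (hα1 : α < 1) (hirr : ¬ ∃ m : ℕ, 1 / α = (m : ℝ))
    (N : ℕ) (hN : N = ⌊1 / α⌋₊) (d : ℕ) (hd : 1 ≤ d)
    (Γ : ℝ → Fin d → ℝ) (hsupp : HasCompactSupport Γ)
    (hHolder : ∃ C : ℝ, ∀ s t : ℝ, s ≠ t → ‖Γ t - Γ s‖ ≤ C * |t - s| ^ α) :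
    ∃ X : (n : ℕ) → (Fin n → Fin d) → ℝ → ℝ → ℝ,
      -- (0) level one consists of the increments of Γ
      (∀ (i : Fin d) (t s : ℝ), X 1 (fun _ => i) t s = Γ t i - Γ s i) ∧
      -- (i) Hölder continuity
      (∀ n : ℕ, 1 ≤ n → n ≤ N → ∀ w : Fin n → Fin d,
        ∃ C : ℝ, ∀ s t : ℝ, s ≠ t → |X n w t s| ≤ C * |t - s| ^ ((n : ℝ) * α)) ∧
      -- (ii) multiplicative/Chen property
      (∀ n : ℕ, 2 ≤ n → n ≤ N → ∀ (w : Fin n → Fin d) (t u s : ℝ),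
        X n w t s - X n w t u - X n w u s =
          ∑ k ∈ Finset.univ.filter (fun k : Fin n => 0 < k.1),
            X k.1 (fun j => w ⟨j.1, by have h1 := j.isLt; have h2 := k.isLt; omega⟩) t u *
              X (n - k.1)
                (fun j => w ⟨k.1 + j.1, by have h1 := j.isLt; have h2 := k.isLt; omega⟩) u s) ∧
      -- (iii) geometric/shuffle property
      (∀ n₁ n₂ : ℕ, 1 ≤ n₁ → 1 ≤ n₂ → n₁ + n₂ ≤ N →
        ∀ (u : Fin n₁ → Fin d) (v : Fin n₂ → Fin d) (t s : ℝ),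
          X n₁ u t s * X n₂ v t s =
            ∑ S : {S : Finset (Fin (n₁ + n₂)) // S.card = n₁},
              X (n₁ + n₂) (shuffleWord u v S.1 S.2) t s) := by
  obtain ⟨C, hC⟩ := hHolder
  obtain ⟨R, hR, hΓR⟩ : ∃ R : ℝ, 0 < R ∧ ∀ t, R ≤ |t| → Γ t = 0 := by
    obtain ⟨r, hr⟩ := hsupp.isCompact.isBounded.subset_closedBall 0
    refine ⟨|r| + 1, by positivity, fun t ht => ?_⟩
    by_contra h
    have h1 := hr (subset_tsupport Γ h)
    rw [mem_closedBall_zero_iff, Real.norm_eq_abs] at h1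
    linarith [le_abs_self r]
  have hR2 : 0 < 2 * R := by positivity
  set φ : ℝ → ℝ := fun t => max 0 (min 1 ((t + R) / (2 * R))) with hφ
  have hφI : ∀ t, φ t ∈ Set.Icc (0 : ℝ) 1 := fun t =>
    ⟨le_max_left _ _, max_le zero_le_one (min_le_left _ _)⟩
  have hφL : ∀ t s, |φ t - φ s| ≤ |t - s| / (2 * R) := fun t s => by
    have h1 : (t + R) / (2 * R) - (s + R) / (2 * R) = (t - s) / (2 * R) := by ring
    rw [hφ, ← abs_of_pos hR2, ← abs_div, abs_of_pos hR2, ← h1]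
    refine (abs_max_sub_max_le_max _ _ _ _).trans (max_le (by simp) ?_)
    exact (abs_min_sub_min_le_max _ _ _ _).trans (max_le (by simp) le_rfl)
  set G : ℝ → Fin d → ℝ := fun x => Γ (2 * R * x - R) with hG
  have hΓG : ∀ t, G (φ t) = Γ t := fun t => by
    rcases le_total t (-R) with h | h
    · have h1 : (t + R) / (2 * R) ≤ 0 := div_nonpos_of_nonpos_of_nonneg (by linarith) hR2.le
      rw [hΓR t (by rw [abs_of_nonpos] <;> linarith)]
      simp only [hG, hφ, max_eq_left ((min_le_right _ _).trans h1)]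
      exact hΓR _ (by simp [le_abs_self])
    rcases le_total t R with h' | h'
    · have h1 : 0 ≤ (t + R) / (2 * R) := div_nonneg (by linarith) hR2.le
      have h2 : (t + R) / (2 * R) ≤ 1 := by rw [div_le_one hR2]; linarith
      simp only [hG, hφ, min_eq_right h2, max_eq_right h1, mul_div_cancel₀ _ hR2.ne']
      simp
    · have h1 : 1 ≤ (t + R) / (2 * R) := by rw [one_le_div hR2]; linarith
      rw [hΓR t (h'.trans (le_abs_self t))]
      simp only [hG, hφ, min_eq_left h1, max_eq_right zero_le_one]
      exact hΓR _ (le_trans (by linarith) (le_abs_self _))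
  have hGH : ∀ i, HolderBound α fun t s => G t i - G s i := fun i => by
    refine ⟨|C| * (2 * R) ^ α, fun t _ s _ => ?_⟩
    rcases eq_or_ne s t with rfl | hst
    · simpa using by positivity
    have h1 : 2 * R * t - R - (2 * R * s - R) = 2 * R * (t - s) := by ring
    have h2 : 2 * R * s - R ≠ 2 * R * t - R := by simpa [hR.ne'] using hst
    calc |G t i - G s i| ≤ ‖G t - G s‖ := norm_le_pi_norm (G t - G s) i
      _ ≤ C * |2 * R * (t - s)| ^ α := h1 ▸ hC _ _ h2
      _ ≤ |C| * |2 * R * (t - s)| ^ α := by gcongr; exact le_abs_self C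
      _ = |C| * (2 * R) ^ α * |t - s| ^ α := by
        rw [abs_mul, abs_of_pos hR2, Real.mul_rpow hR2.le (abs_nonneg _), mul_assoc]
  have hN1 : 1 ≤ N := by
    rw [hN, Nat.one_le_floor_iff, one_le_div hα0]
    exact hα1.le
  have hNα : N * α < 1 := by
    rw [← lt_div_iff₀ hα0]
    refine lt_of_le_of_ne (hN ▸ Nat.floor_le (by positivity)) fun h => hirr ⟨N, h.symm⟩
  obtain ⟨Y, hY, hinc, hH⟩ := exists_groupLike_lift hα0 G hGH hN1 hNα
  refine ⟨fun n w t s => conv (Y (φ t)) (convInv (Y (φ s))) (List.ofFn w), fun i t s => ?_,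
    fun n _ hn w => ?_, fun n hn _ w t u s => ?_, fun n₁ n₂ h₁ _ _ u v t s => ?_⟩
  · simp [hinc, hΓG]
  · obtain ⟨D, hD⟩ := hH (List.ofFn w) (by simpa using hn)
    rw [List.length_ofFn] at hD
    refine ⟨|D| / (2 * R) ^ (n * α), fun s t _ => (hD _ (hφI t) _ (hφI s)).trans ?_⟩
    calc D * |φ t - φ s| ^ (n * α) ≤ |D| * (|t - s| / (2 * R)) ^ (n * α) := by
          gcongr
          · exact le_abs_self D
          · exact hφL t s
      _ = |D| / (2 * R) ^ (n * α) * |t - s| ^ (n * α) := by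
        rw [Real.div_rpow (abs_nonneg _) hR2.le]
        ring
  · beta_reduce
    conv_lhs => rw [← conv_conv_convInv (a := Y (φ t)) (b := Y (φ u)) (c := Y (φ s)) (hY _).1,
      conv_ofFn _ _ w (by omega)]
    simp only [conv_nil, (hY _).1, convInv_nil]
    ring
  · beta_reduce
    rw [sum_shuffleWord h₁, ((hY _).conv (hY _).convInv).2]
end

section
/- Let α ∈ (0,1) with 1/α ∉ ℕ, let N = ⌊1/α⌋, let d ≥ 1, T > 0, and let Γ : [0,T] → ℝ^d be a continuous path of finite 1/α-variation, i.e. sup over all finite partitions 0 = t_0 ≤ … ≤ t_m = T of Σ_{j} ‖Γ(t_{j+1}) − Γ(t_j)‖^{1/α} is finite. Then there exists a family of real-valued functions Γ^n_{ts}(i_1,…,i_n), indexed by n ∈ {1,…,N}, words in {1,…,d}^n and s,t ∈ [0,T], such that: (0) Γ^1_{ts}(i) = Γ_t(i) − Γ_s(i); (ii) (Chen) Γ^n_{ts}(i_1,…,i_n) − Γ^n_{tu}(i_1,…,i_n) − Γ^n_{us}(i_1,…,i_n) = Σ_{k=1}^{n−1} Γ^k_{tu}(i_1,…,i_k) ·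 Γ^{n−k}_{us}(i_{k+1},…,i_n) for all s,u,t ∈ [0,T]; (iii) (shuffle) whenever n_1+n_2 ≤ N, Γ^{n_1}_{ts}(i_1,…,i_{n_1}) · Γ^{n_2}_{ts}(j_1,…,j_{n_2}) = Σ_S Γ^{n_1+n_2}_{ts}(k^S), the sum over all subsets S ⊆ {1,…,n_1+n_2} with |S| = n_1; and (i') each Γ^n(i_1,…,i_n) has finite 1/(nα)-variation, i.e. sup over all finite partitions 0 = t_0 ≤ … ≤ t_m = T of Σ_j |Γ^n_{t_{j+1} t_j}(i_1,…,i_n)|^{1/(nα)} < ∞. -/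
namespace RoughLift

/-- Values at the dyadic points `m / 2 ^ k`, defined by midpoint correction. -/
noncomputable def dyadicPrimitive {W : Type*} [AddCommGroup W] [Module ℝ W] (E : ℝ → ℝ → W) :
    ℕ → ℕ → W
  | 0, m => if m = 0 then 0 else E 1 0
  | k + 1, m =>
    let p := dyadicPrimitive E k (m / 2)
    let q := dyadicPrimitive E k (m / 2 + 1)
    let l := E (((2 * (m / 2) + 1 : ℕ) : ℝ) / 2 ^ (k + 1)) (((m / 2 : ℕ) : ℝ) / 2 ^ k)
    let r := E (((m / 2 + 1 : ℕ) : ℝ) / 2 ^ k) (((2 * (m / 2) + 1 : ℕ) : ℝ) / 2 ^ (k + 1))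
    if m % 2 = 0 then p else p + l + (2⁻¹ : ℝ) • (q - p - l - r)

section

open Filter Topology

variable {W : Type*} [NormedAddCommGroup W] [NormedSpace ℝ W]

lemma dyadicPrimitive_even (E : ℝ → ℝ → W) (k m : ℕ) :
    dyadicPrimitive E (k + 1) (2 * m) = dyadicPrimitive E k m := by
  simp [dyadicPrimitive]

lemma dyadicPrimitive_odd (E : ℝ → ℝ → W) (k m : ℕ) :
    dyadicPrimitive E (k + 1) (2 * m + 1) = dyadicPrimitive E k m +
      E (((2 * m + 1 : ℕ) : ℝ) / 2 ^ (k + 1)) ((m : ℝ) / 2 ^ k) +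
      (2⁻¹ : ℝ) • (dyadicPrimitive E k (m + 1) - dyadicPrimitive E k m -
        E (((2 * m + 1 : ℕ) : ℝ) / 2 ^ (k + 1)) ((m : ℝ) / 2 ^ k) -
        E (((m + 1 : ℕ) : ℝ) / 2 ^ k) (((2 * m + 1 : ℕ) : ℝ) / 2 ^ (k + 1))) := by
  have h1 : (2 * m + 1) / 2 = m := by omega
  have h2 : (2 * m + 1) % 2 ≠ 0 := by omega
  rw [dyadicPrimitive]
  simp only [h1, h2, if_false]

lemma dyadic_bounds {k m : ℕ} (h : m + 1 ≤ 2 ^ k) :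
    (0 : ℝ) ≤ (m : ℝ) / 2 ^ k ∧
    (m : ℝ) / 2 ^ k ≤ ((2 * m + 1 : ℕ) : ℝ) / 2 ^ (k + 1) ∧
    ((2 * m + 1 : ℕ) : ℝ) / 2 ^ (k + 1) ≤ ((m + 1 : ℕ) : ℝ) / 2 ^ k ∧
    ((m + 1 : ℕ) : ℝ) / 2 ^ k ≤ 1 ∧
    ((m + 1 : ℕ) : ℝ) / 2 ^ k - (m : ℝ) / 2 ^ k = 1 / 2 ^ k := by
  have hp : (0 : ℝ) < 2 ^ k := by positivity
  have h' : ((m : ℝ) + 1) ≤ 2 ^ k := by exact_mod_cast h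
  refine ⟨by positivity, ?_, ?_, ?_, ?_⟩
  · rw [div_le_div_iff₀ hp (by positivity)]; push_cast; rw [pow_succ]; nlinarith
  · rw [div_le_div_iff₀ (by positivity) hp]; push_cast; rw [pow_succ]; nlinarith
  · rw [div_le_one hp]; push_cast; exact h'
  · push_cast; field_simp; ring

/-- On dyadic intervals, the increments of the dyadic primitive approximate `E`. -/
lemma dyadicPrimitive_consecutive {E : ℝ → ℝ → W} {C q K : ℝ} (hK : 0 ≤ K)
    (hq : 0 ≤ q) (hCK : C + K ≤ 2 * q * K)
    (hE : ∀ k : ℕ, ∀ s u t : ℝ, 0 ≤ s → s ≤ u → u ≤ t → t ≤ 1 → t - s ≤ 1 / 2 ^ k →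
      ‖E t s - E t u - E u s‖ ≤ C * q ^ k) (k m : ℕ) (hm : m + 1 ≤ 2 ^ k) :
    ‖E (((m + 1 : ℕ) : ℝ) / 2 ^ k) ((m : ℝ) / 2 ^ k) -
      (dyadicPrimitive E k (m + 1) - dyadicPrimitive E k m)‖ ≤ K * q ^ k := by
  induction k generalizing m with
  | zero =>
    have : m = 0 := by simpa using hm
    subst this
    simpa [dyadicPrimitive] using hK
  | succ k ih =>
    obtain ⟨n, hn⟩ := Nat.even_or_odd' m
    have hn' : n + 1 ≤ 2 ^ k := by rw [pow_succ] at hm; omega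
    obtain ⟨b0, b1, b2, b3, b4⟩ := dyadic_bounds hn'
    have H := ih n hn'
    have D := hE k _ _ _ b0 b1 b2 b3 b4.le
    have hbound : 2⁻¹ * (K * q ^ k + C * q ^ k) ≤ K * q ^ (k + 1) := by
      have := mul_le_mul_of_nonneg_right hCK (pow_nonneg hq k)
      rw [pow_succ]; nlinarith
    have e0 : ((2 * n : ℕ) : ℝ) / 2 ^ (k + 1) = (n : ℝ) / 2 ^ k := by
      push_cast; rw [pow_succ]; field_simp
    have e2 : ((2 * n + 1 + 1 : ℕ) : ℝ) / 2 ^ (k + 1) = ((n + 1 : ℕ) : ℝ) / 2 ^ k := by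
      push_cast; rw [pow_succ]; field_simp; ring
    have f2 : dyadicPrimitive E (k + 1) (2 * n + 1 + 1) = dyadicPrimitive E k (n + 1) := by
      exact dyadicPrimitive_even E k (n + 1)
    rcases hn with rfl | rfl
    · rw [e0, dyadicPrimitive_even, dyadicPrimitive_odd]
      set x := E (((n + 1 : ℕ) : ℝ) / 2 ^ k) ((n : ℝ) / 2 ^ k)
      set y := E (((n + 1 : ℕ) : ℝ) / 2 ^ k) (((2 * n + 1 : ℕ) : ℝ) / 2 ^ (k + 1))
      set z := E (((2 * n + 1 : ℕ) : ℝ) / 2 ^ (k + 1)) ((n : ℝ) / 2 ^ k)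
      set p := dyadicPrimitive E k n
      set r := dyadicPrimitive E k (n + 1)
      have : z - (p + z + (2⁻¹ : ℝ) • (r - p - z - y) - p) =
          (2⁻¹ : ℝ) • ((x - (r - p)) - (x - y - z)) := by module
      rw [this, norm_smul]
      refine le_trans ?_ hbound
      rw [Real.norm_of_nonneg (by norm_num)]
      exact mul_le_mul_of_nonneg_left ((norm_sub_le _ _).trans (add_le_add H D)) (by norm_num)
    · rw [e2, f2, dyadicPrimitive_odd]
      set x := E (((n + 1 : ℕ) : ℝ) / 2 ^ k) ((n : ℝ) / 2 ^ k)
      set y := E (((n + 1 : ℕ) : ℝ) / 2 ^ k) (((2 * n + 1 : ℕ) : ℝ) / 2 ^ (k + 1))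
      set z := E (((2 * n + 1 : ℕ) : ℝ) / 2 ^ (k + 1)) ((n : ℝ) / 2 ^ k)
      set p := dyadicPrimitive E k n
      set r := dyadicPrimitive E k (n + 1)
      have : y - (r - (p + z + (2⁻¹ : ℝ) • (r - p - z - y))) =
          (2⁻¹ : ℝ) • ((x - (r - p)) - (x - y - z)) := by module
      rw [this, norm_smul]
      refine le_trans ?_ hbound
      rw [Real.norm_of_nonneg (by norm_num)]
      exact mul_le_mul_of_nonneg_left ((norm_sub_le _ _).trans (add_le_add H D)) (by norm_num)

lemma dyadic_floor {t : ℝ} (h0 : 0 ≤ t) (h1 : t ≤ 1) (k : ℕ) :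
    (⌊t * 2 ^ k⌋₊ : ℝ) / 2 ^ k ≤ t ∧ t - (⌊t * 2 ^ k⌋₊ : ℝ) / 2 ^ k ≤ 1 / 2 ^ k ∧
      ⌊t * 2 ^ k⌋₊ ≤ 2 ^ k := by
  have hp : (0 : ℝ) < 2 ^ k := by positivity
  have hf := Nat.floor_le (a := t * 2 ^ k) (by positivity)
  have hl := Nat.lt_floor_add_one (t * 2 ^ k)
  refine ⟨?_, ?_, ?_⟩
  · rwa [div_le_iff₀ hp]
  · rw [sub_le_iff_le_add, ← add_div, le_div_iff₀ hp]; linarith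
  · have : (⌊t * 2 ^ k⌋₊ : ℝ) ≤ 2 ^ k := hf.trans (by nlinarith)
    exact_mod_cast this

/-- A germ whose coboundary is of order `γ < 1` is the increment of a function up to an error of
order `γ`. -/
theorem exists_primitive_of_coboundary_bound [CompleteSpace W] {γ : ℝ} (hγ0 : 0 < γ) (hγ1 : γ < 1)
    {E : ℝ → ℝ → W} {C : ℝ}
    (hE : ∀ s u t : ℝ, 0 ≤ s → s ≤ u → u ≤ t → t ≤ 1 →
      ‖E t s - E t u - E u s‖ ≤ C * (t - s) ^ γ) :
    ∃ (f : ℝ → W) (K : ℝ), ∀ s t : ℝ, 0 ≤ s → s ≤ t → t ≤ 1 →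
      ‖E t s - (f t - f s)‖ ≤ K * (t - s) ^ γ := by
  have hC : 0 ≤ C := by
    have := hE 0 0 1 le_rfl le_rfl zero_le_one le_rfl
    simp only [sub_zero, Real.one_rpow, mul_one] at this
    exact (norm_nonneg _).trans this
  set q : ℝ := (1 / 2 : ℝ) ^ γ with hqdef
  have hq0 : 0 < q := by positivity
  have hq1 : q < 1 := Real.rpow_lt_one (by norm_num) (by norm_num) hγ0
  have hq2 : 1 < 2 * q := by
    have : (1 / 2 : ℝ) ^ (1 : ℝ) < q :=
      Real.rpow_lt_rpow_of_exponent_gt (by norm_num) (by norm_num) hγ1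
    rw [Real.rpow_one] at this; linarith
  have hpow (k : ℕ) : ((1 : ℝ) / 2 ^ k) ^ γ = q ^ k := by
    rw [hqdef, ← one_div_pow, ← Real.rpow_natCast, ← Real.rpow_mul (by norm_num), mul_comm,
      Real.rpow_mul (by norm_num), Real.rpow_natCast]
  have hE' (k : ℕ) (s u t : ℝ) (h0 : 0 ≤ s) (hsu : s ≤ u) (hut : u ≤ t) (h1 : t ≤ 1)
      (hk : t - s ≤ 1 / 2 ^ k) : ‖E t s - E t u - E u s‖ ≤ C * q ^ k := by
    refine (hE s u t h0 hsu hut h1).trans (mul_le_mul_of_nonneg_left ?_ hC)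
    rw [← hpow]
    exact Real.rpow_le_rpow (by linarith) hk hγ0.le
  set K : ℝ := C / (2 * q - 1) with hKdef
  have hK : 0 ≤ K := div_nonneg hC (by linarith)
  have hCK : C + K ≤ 2 * q * K := by
    have : K * (2 * q - 1) = C := div_mul_cancel₀ _ (by linarith)
    linarith
  have hcons := dyadicPrimitive_consecutive hK hq0.le hCK hE'
  set P := dyadicPrimitive E
  let a : ℕ → ℝ → ℝ := fun k t => (⌊t * 2 ^ k⌋₊ : ℝ) / 2 ^ k
  let F : ℕ → ℝ → W := fun k t => P k ⌊t * 2 ^ k⌋₊ + E t (a k t)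
  have hstep (t : ℝ) (h0 : 0 ≤ t) (h1 : t ≤ 1) (k : ℕ) :
      dist (F k t) (F (k + 1) t) ≤ (K + C) * q ^ k := by
    obtain ⟨c1, c2, c3⟩ := dyadic_floor h0 h1 k
    obtain ⟨d1, d2, d3⟩ := dyadic_floor h0 h1 (k + 1)
    have hm : ⌊t * 2 ^ k⌋₊ = ⌊t * 2 ^ (k + 1)⌋₊ / 2 := by
      rw [← Nat.floor_div_ofNat]
      congr 1
      rw [pow_succ]; field_simp
    simp only [F, a]
    set m := ⌊t * 2 ^ k⌋₊
    set m' := ⌊t * 2 ^ (k + 1)⌋₊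
    have hq' : 0 ≤ (K + C) * q ^ k := by positivity
    rcases Nat.mod_two_eq_zero_or_one m' with h | h
    · have e : m' = 2 * m := by omega
      have e0 : ((2 * m : ℕ) : ℝ) / 2 ^ (k + 1) = (m : ℝ) / 2 ^ k := by
        push_cast; rw [pow_succ]; field_simp
      rw [e, e0, show P (k + 1) (2 * m) = P k m from dyadicPrimitive_even E k m]
      simpa using hq'
    · have e : m' = 2 * m + 1 := by omega
      have e0 : ((2 * m : ℕ) : ℝ) / 2 ^ (k + 1) = (m : ℝ) / 2 ^ k := by
        push_cast; rw [pow_succ]; field_simp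
      have hmk : m + 1 ≤ 2 ^ k := by rw [pow_succ] at d3; omega
      have H := hcons (k + 1) (2 * m) (by rw [pow_succ]; omega)
      rw [e0, show P (k + 1) (2 * m) = P k m from dyadicPrimitive_even E k m] at H
      obtain ⟨b0, b1, b2, b3, b4⟩ := dyadic_bounds hmk
      rw [e] at d1 d2 ⊢
      have D := hE' k _ _ _ b0 b1 d1 h1 c2
      rw [dist_eq_norm]
      set x := E (((2 * m + 1 : ℕ) : ℝ) / 2 ^ (k + 1)) ((m : ℝ) / 2 ^ k)
      have : P k m + E t ((m : ℝ) / 2 ^ k) -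
          (P (k + 1) (2 * m + 1) + E t (((2 * m + 1 : ℕ) : ℝ) / 2 ^ (k + 1))) =
          (x - (P (k + 1) (2 * m + 1) - P k m)) +
            (E t ((m : ℝ) / 2 ^ k) - E t (((2 * m + 1 : ℕ) : ℝ) / 2 ^ (k + 1)) - x) := by
        abel
      rw [this]
      refine (norm_add_le _ _).trans ((add_le_add H D).trans ?_)
      have : q ^ (k + 1) ≤ q ^ k := pow_le_pow_of_le_one hq0.le hq1.le (by omega)
      nlinarith
  have hlim (t : ℝ) (h0 : 0 ≤ t) (h1 : t ≤ 1) : ∃ x : W, Tendsto (fun k => F k t) atTop (𝓝 x) :=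
    cauchySeq_tendsto_of_complete (cauchySeq_of_le_geometric q (K + C) hq1 (hstep t h0 h1))
  classical
  let f : ℝ → W := fun t => if h : 0 ≤ t ∧ t ≤ 1 then (hlim t h.1 h.2).choose else 0
  have hf (t : ℝ) (h0 : 0 ≤ t) (h1 : t ≤ 1) (k : ℕ) :
      ‖F k t - f t‖ ≤ (K + C) * q ^ k / (1 - q) := by
    have : Tendsto (fun k => F k t) atTop (𝓝 (f t)) := by
      simp only [f, h0, h1, and_self, dif_pos]
      exact (hlim t h0 h1).choose_spec
    rw [← dist_eq_norm]
    exact dist_le_of_le_geometric_of_tendsto q (K + C) hq1 (hstep t h0 h1) this k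
  set B : ℝ := (K + C) / (1 - q) with hB
  have hB0 : 0 ≤ B := div_nonneg (by positivity) (by linarith)
  refine ⟨f, (2 * B + K + 2 * C) * q⁻¹, fun s t h0 hst h1 => ?_⟩
  rcases hst.eq_or_lt with rfl | hlt
  · have := hE s s s h0 le_rfl le_rfl h1
    simp only [sub_self, Real.zero_rpow hγ0.ne', mul_zero, zero_sub, norm_neg] at this ⊢
    simpa using this
  obtain ⟨k, hk1, hk2⟩ := exists_nat_pow_near_of_lt_one (x := t - s) (y := (1 / 2 : ℝ))
    (by linarith) (by linarith) (by norm_num) (by norm_num)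
  have hqk : q ^ k ≤ q⁻¹ * (t - s) ^ γ := by
    rw [le_inv_mul_iff₀ hq0, ← pow_succ', ← hpow, ← one_div_pow]
    exact Real.rpow_le_rpow (by positivity) hk1.le hγ0.le
  rw [one_div_pow] at hk2
  have hmain : ‖E t s - (F k t - F k s)‖ ≤ (K + 2 * C) * q ^ k := by
    obtain ⟨c1, c2, c3⟩ := dyadic_floor h0 (hst.trans h1) k
    obtain ⟨d1, d2, d3⟩ := dyadic_floor (h0.trans hst) h1 k
    have hle : ⌊s * 2 ^ k⌋₊ ≤ ⌊t * 2 ^ k⌋₊ :=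
      Nat.floor_le_floor (mul_le_mul_of_nonneg_right hst (by positivity))
    have hle' : ⌊t * 2 ^ k⌋₊ ≤ ⌊s * 2 ^ k⌋₊ + 1 := by
      rw [← Nat.floor_add_one (by positivity)]
      refine Nat.floor_le_floor ?_
      have := (le_div_iff₀ (by positivity : (0 : ℝ) < 2 ^ k)).1 hk2
      linarith
    have hsl := Nat.lt_floor_add_one (s * 2 ^ k)
    simp only [F, a]
    set m := ⌊s * 2 ^ k⌋₊
    set m' := ⌊t * 2 ^ k⌋₊
    have hCq : 0 ≤ C * q ^ k := by positivity
    have hKq : 0 ≤ K * q ^ k := by positivity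
    rcases (show m' = m ∨ m' = m + 1 by omega) with e | e
    · rw [e] at d1 d2 ⊢
      have D := hE' k _ _ _ (by positivity) c1 hst h1 d2
      rw [← norm_neg] at D
      have : E t s - (P k m + E t ((m : ℝ) / 2 ^ k) - (P k m + E s ((m : ℝ) / 2 ^ k))) =
          -(E t ((m : ℝ) / 2 ^ k) - E t s - E s ((m : ℝ) / 2 ^ k)) := by abel
      rw [this]
      linarith
    · rw [e] at d1 d2 d3 ⊢
      have hsb : s ≤ ((m + 1 : ℕ) : ℝ) / 2 ^ k := by
        rw [le_div_iff₀ (by positivity)]; push_cast; exact hsl.le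
      obtain ⟨b0, b1, b2, b3, b4⟩ := dyadic_bounds d3
      have D1 := hE' k _ _ _ h0 hsb d1 h1 hk2
      have D2 := hE' k _ _ _ b0 c1 hsb b3 b4.le
      have H := hcons k m d3
      set y := ((m + 1 : ℕ) : ℝ) / 2 ^ k
      set x := (m : ℝ) / 2 ^ k
      have : E t s - (P k (m + 1) + E t y - (P k m + E s x)) =
          (E y x - (P k (m + 1) - P k m)) + (E t s - E t y - E y s) -
            (E y x - E y s - E s x) := by abel
      rw [this]
      refine (norm_sub_le _ _).trans ((add_le_add_left (norm_add_le _ _) _).trans ?_)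
      linarith
  have h2 := hf t (h0.trans hst) h1 k
  have h3 := hf s h0 (hst.trans h1) k
  have e : E t s - (f t - f s) = (E t s - (F k t - F k s)) + (F k t - f t) - (F k s - f s) := by
    abel
  have hBq : (K + C) * q ^ k / (1 - q) = B * q ^ k := by rw [hB]; ring
  rw [hBq] at h2 h3
  calc ‖E t s - (f t - f s)‖ ≤ (K + 2 * C) * q ^ k + B * q ^ k + B * q ^ k := by
        rw [e]
        exact (norm_sub_le _ _).trans
          (add_le_add ((norm_add_le _ _).trans (add_le_add hmain h2)) h3)
    _ = (2 * B + K + 2 * C) * q ^ k := by ring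
    _ ≤ (2 * B + K + 2 * C) * (q⁻¹ * (t - s) ^ γ) :=
        mul_le_mul_of_nonneg_left hqk (by positivity)
    _ = _ := by ring

end


open Finset

variable {A : Type*}

/-- The sum of `g` over all shuffles of the words `u` and `v`. -/
def shuffleSum : List A → List A → (List A → ℝ) → ℝ
  | [], v, g => g v
  | a :: u, [], g => g (a :: u)
  | a :: u, b :: v, g =>
      shuffleSum u (b :: v) (fun w => g (a :: w)) + shuffleSum (a :: u) v (fun w => g (b :: w))
termination_by u v => u.length + v.length

/-- The convolution of two functions on words, dual to deconcatenation. -/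
def conv (g h : List A → ℝ) (w : List A) : ℝ :=
  ∑ k ∈ range (w.length + 1), g (w.take k) * h (w.drop k)

@[simp] lemma shuffleSum_nil_left (v : List A) (g : List A → ℝ) : shuffleSum [] v g = g v := by
  rw [shuffleSum]

@[simp] lemma shuffleSum_nil_right (u : List A) (g : List A → ℝ) : shuffleSum u [] g = g u := by
  cases u <;> rw [shuffleSum]

lemma shuffleSum_cons_cons (a b : A) (u v : List A) (g : List A → ℝ) :
    shuffleSum (a :: u) (b :: v) g = shuffleSum u (b :: v) (fun w => g (a :: w)) +
      shuffleSum (a :: u) v (fun w => g (b :: w)) := by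
  rw [shuffleSum]

lemma shuffleSum_congr (u v : List A) {g h : List A → ℝ}
    (H : ∀ w : List A, w.length = u.length + v.length → g w = h w) :
    shuffleSum u v g = shuffleSum u v h := by
  induction u, v, g using shuffleSum.induct generalizing h with
  | case1 v g => simpa using H v (by simp)
  | case2 a u g => simpa using H (a :: u) (by simp)
  | case3 a u b v g ih1 ih2 =>
    rw [shuffleSum_cons_cons, shuffleSum_cons_cons]
    congr 1
    · exact ih1 fun w hw => H _ (by simp [hw]; omega)
    · exact ih2 fun w hw => H _ (by simp [hw]; omega)

lemma shuffleSum_linear (u v : List A) (c : ℝ) (g h : List A → ℝ) :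
    shuffleSum u v (fun w => c * g w + h w) = c * shuffleSum u v g + shuffleSum u v h := by
  induction u, v, g using shuffleSum.induct generalizing h with
  | case1 v g => simp
  | case2 a u g => simp
  | case3 a u b v g ih1 ih2 =>
    rw [shuffleSum_cons_cons, shuffleSum_cons_cons, shuffleSum_cons_cons, ih1, ih2]
    ring

lemma shuffleSum_zero (u v : List A) : shuffleSum u v (fun _ => 0) = 0 := by
  simpa using shuffleSum_linear u v (-1) (fun _ => 0) (fun _ => 0)

lemma shuffleSum_const_mul (u v : List A) (c : ℝ) (g : List A → ℝ) :
    shuffleSum u v (fun w => c * g w) = c * shuffleSum u v g := by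
  simpa [shuffleSum_zero] using shuffleSum_linear u v c g (fun _ => 0)

lemma conv_nil (g h : List A → ℝ) : conv g h [] = g [] * h [] := by simp [conv]

lemma conv_cons (g h : List A → ℝ) (a : A) (w : List A) :
    conv g h (a :: w) = g [] * h (a :: w) + conv (fun x => g (a :: x)) h w := by
  simp only [conv, List.length_cons]
  rw [sum_range_succ']
  simp [add_comm]

lemma conv_linear_left (c : ℝ) (g g' h : List A → ℝ) (w : List A) :
    conv (fun x => c * g x + g' x) h w = c * conv g h w + conv g' h w := by
  simp only [conv, mul_sum, ← sum_add_distrib]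
  exact sum_congr rfl fun _ _ => by ring

lemma conv_assoc (g h k : List A → ℝ) (w : List A) :
    conv (conv g h) k w = conv g (conv h k) w := by
  induction w generalizing g h with
  | nil => simp [conv_nil, mul_assoc]
  | cons a w ih =>
    simp only [conv_cons, conv_nil, conv_linear_left, ih]
    ring

lemma conv_congr {g g' h h' : List A → ℝ} {w : List A}
    (hg : ∀ x : List A, x.length ≤ w.length → g x = g' x)
    (hh : ∀ x : List A, x.length ≤ w.length → h x = h' x) : conv g h w = conv g' h' w := by
  refine sum_congr rfl fun k _ => ?_
  rw [hg _ (by simp), hh _ (by simp)]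

/-- The part of the convolution coming from proper deconcatenations. -/
lemma conv_eq_proper (g h : List A → ℝ) (w : List A) (hw : w ≠ []) (hg : g [] = 1)
    (hh : h [] = 1) :
    conv g h w = g w + h w +
      ∑ k ∈ range (w.length - 1), g (w.take (k + 1)) * h (w.drop (k + 1)) := by
  have hl : 0 < w.length := List.length_pos_iff.2 hw
  obtain ⟨m, hm⟩ : ∃ m, w.length = m + 1 := ⟨w.length - 1, by omega⟩
  have ht : w.take (m + 1) = w := List.take_of_length_le hm.le
  have hd : w.drop (m + 1) = [] := List.drop_of_length_le hm.le
  rw [conv, hm, sum_range_succ, sum_range_succ', ht, hd, hh]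
  simp [hg]
  ring

lemma conv_update {g g' h h' : List A → ℝ} {w : List A} (hw : w ≠ [])
    (hg : ∀ x : List A, x.length < w.length → g' x = g x)
    (hh : ∀ x : List A, x.length < w.length → h' x = h x) (hg1 : g [] = 1) (hh1 : h [] = 1) :
    conv g' h' w = conv g h w + (g' w - g w) + (h' w - h w) := by
  have hl : 0 < w.length := List.length_pos_iff.2 hw
  rw [conv_eq_proper g' h' w hw (by rw [hg _ (by simpa), hg1]) (by rw [hh _ (by simpa), hh1]),
    conv_eq_proper g h w hw hg1 hh1]
  have : ∑ k ∈ range (w.length - 1), g' (w.take (k + 1)) * h' (w.drop (k + 1)) =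
      ∑ k ∈ range (w.length - 1), g (w.take (k + 1)) * h (w.drop (k + 1)) := by
    refine sum_congr rfl fun k hk => ?_
    rw [mem_range] at hk
    rw [hg _ (by simp; omega), hh _ (by simp; omega)]
  rw [this]
  ring

/-- Deconcatenation is a morphism for the shuffle product. -/
lemma shuffleSum_conv (u v : List A) (g h : List A → ℝ) :
    shuffleSum u v (conv g h) = ∑ i ∈ range (u.length + 1), ∑ j ∈ range (v.length + 1),
      shuffleSum (u.take i) (v.take j) g * shuffleSum (u.drop i) (v.drop j) h := by
  induction hN : u.length + v.length using Nat.strong_induction_on generalizing u v g with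
  | _ N ih =>
  match u, v with
  | [], v => simp [conv]
  | a :: u, [] => simp [conv]
  | a :: u, b :: v =>
    have e (c : A) : (fun w => conv g h (c :: w)) =
        fun w => g [] * (fun x => h (c :: x)) w + conv (fun x => g (c :: x)) h w := by
      funext w; rw [conv_cons]
    rw [shuffleSum_cons_cons, e, e, shuffleSum_linear, shuffleSum_linear,
      ih _ (by simp at hN ⊢; omega) u (b :: v) _ rfl,
      ih _ (by simp at hN ⊢; omega) (a :: u) v _ rfl]
    simp only [List.length_cons]
    rw [sum_range_succ' _ (u.length + 1), sum_range_succ' _ (u.length + 1)]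
    have e1 : ∀ G : ℕ → ℕ → ℝ, ∑ i ∈ range (u.length + 1), ∑ j ∈ range (v.length + 1 + 1), G i j =
        ∑ i ∈ range (u.length + 1), ∑ j ∈ range (v.length + 1), G i (j + 1) +
        ∑ i ∈ range (u.length + 1), G i 0 := by
      intro G
      rw [← sum_add_distrib]
      exact sum_congr rfl fun i _ => sum_range_succ' _ _
    rw [e1, e1, sum_range_succ' _ (v.length + 1)]
    simp only [List.take_succ_cons, List.drop_succ_cons, List.take_zero, List.drop_zero,
      shuffleSum_nil_left, shuffleSum_nil_right, shuffleSum_cons_cons, add_mul, sum_add_distrib]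
    ring

/-- `g` is multiplicative for the shuffle product on words of total length less than `n`. -/
structure IsCharacterBelow (n : ℕ) (g : List A → ℝ) : Prop where
  nil : g [] = 1
  mul : ∀ u v : List A, u.length + v.length < n → shuffleSum u v g = g u * g v

lemma IsCharacterBelow.congr {n : ℕ} {g g' : List A → ℝ} (hg : IsCharacterBelow n g) (hn : 0 < n)
    (h : ∀ w : List A, w.length < n → g' w = g w) : IsCharacterBelow n g' := by
  refine ⟨by rw [h [] hn, hg.nil], fun u v huv => ?_⟩
  rw [shuffleSum_congr u v (h := g) (fun w hw => h w (by omega)), hg.mul u v huv,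
    h u (by omega), h v (by omega)]

/-- The failure of multiplicativity at the first uncontrolled level is additive under
convolution. -/
lemma shuffleSum_conv_defect {n : ℕ} (hn : 0 < n) {g h : List A → ℝ}
    (hg : IsCharacterBelow n g) (hh : IsCharacterBelow n h) (u v : List A)
    (huv : u.length + v.length = n) :
    shuffleSum u v (conv g h) - conv g h u * conv g h v =
      (shuffleSum u v g - g u * g v) + (shuffleSum u v h - h u * h v) := by
  have key (i j : ℕ) (hi : i ≤ u.length) (hj : j ≤ v.length) :
      shuffleSum (u.take i) (v.take j) g * shuffleSum (u.drop i) (v.drop j) h -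
        (g (u.take i) * h (u.drop i)) * (g (v.take j) * h (v.drop j)) =
      (if u.length = i then (if v.length = j then shuffleSum u v g - g u * g v else 0) else 0) +
      (if 0 = i then (if 0 = j then shuffleSum u v h - h u * h v else 0) else 0) := by
    by_cases h1 : u.length = i ∧ v.length = j
    · obtain ⟨rfl, rfl⟩ := h1
      by_cases h0 : 0 = u.length ∧ 0 = v.length
      · omega
      · simp only [List.take_length, List.drop_length, shuffleSum_nil_left, hh.nil, if_true,
          ← ite_and, h0, if_false]
        ring
    · by_cases h0 : 0 = i ∧ 0 = j
      · obtain ⟨rfl, rfl⟩ := h0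
        simp only [List.take_zero, List.drop_zero, shuffleSum_nil_left, hg.nil, if_true,
          ← ite_and, h1, if_false]
        ring
      · rw [hg.mul _ _ (by simp; omega), hh.mul _ _ (by simp; omega), ← ite_and, ← ite_and,
          if_neg h1, if_neg h0]
        ring
  have hprod : conv g h u * conv g h v = ∑ i ∈ range (u.length + 1), ∑ j ∈ range (v.length + 1),
      (g (u.take i) * h (u.drop i)) * (g (v.take j) * h (v.drop j)) := by
    rw [conv, conv, sum_mul_sum]
  rw [shuffleSum_conv, hprod, ← sum_sub_distrib]
  simp only [← sum_sub_distrib]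
  rw [sum_congr rfl fun i hi => sum_congr rfl fun j hj =>
    key i j (by simpa [Nat.lt_succ_iff] using hi) (by simpa [Nat.lt_succ_iff] using hj)]
  simp only [sum_add_distrib]
  simp only [sum_ite_irrel, sum_ite_eq, sum_const_zero, mem_range, Nat.lt_succ_self, if_true,
    Nat.succ_pos]

/-- The convolution of a character with an infinitesimal character. -/
lemma shuffleSum_conv_infinitesimal {g D : List A → ℝ} {u v : List A} (hu : u ≠ []) (hv : v ≠ [])
    (hg : IsCharacterBelow (u.length + v.length) g) (hD0 : D [] = 0)
    (hD : ∀ x y : List A, x ≠ [] → y ≠ [] → x.length + y.length < u.length + v.length →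
      shuffleSum x y D = 0) :
    shuffleSum u v (conv g D) =
      g u * conv g D v + g v * conv g D u + shuffleSum u v D := by
  have hul := List.length_pos_iff.2 hu
  have hvl := List.length_pos_iff.2 hv
  have key (i j : ℕ) (hi : i ≤ u.length) (hj : j ≤ v.length) :
      shuffleSum (u.take i) (v.take j) g * shuffleSum (u.drop i) (v.drop j) D =
      (if u.length = i then g u * (g (v.take j) * D (v.drop j)) else 0) +
      (if v.length = j then g v * (g (u.take i) * D (u.drop i)) else 0) +
      (if 0 = i then (if 0 = j then shuffleSum u v D else 0) else 0) := by
    by_cases h1 : u.length = i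
    · have h0 : 0 ≠ i := by omega
      subst h1
      by_cases h2 : v.length = j
      · subst h2
        simp [hD0, h0]
      · rw [hg.mul _ _ (by simp; omega), if_pos rfl, if_neg h2, if_neg h0]
        simp
        ring
    · by_cases h2 : v.length = j
      · have h0 : 0 ≠ j := by omega
        subst h2
        rw [hg.mul _ _ (by simp; omega), if_pos rfl, if_neg h1, if_neg h0]
        simp
        ring
      · by_cases h0 : 0 = i ∧ 0 = j
        · obtain ⟨rfl, rfl⟩ := h0
          simp [h1, h2, hg.nil]
        · rw [hD (u.drop i) (v.drop j) (by simp; omega) (by simp; omega) (by simp; omega),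
            ← ite_and, if_neg h1, if_neg h2, if_neg h0]
          ring
  rw [shuffleSum_conv, sum_congr rfl fun i hi => sum_congr rfl fun j hj =>
    key i j (by simpa [Nat.lt_succ_iff] using hi) (by simpa [Nat.lt_succ_iff] using hj)]
  simp only [sum_add_distrib, sum_ite_irrel, sum_ite_eq, sum_const_zero, mem_range,
    Nat.lt_succ_self, if_true, Nat.succ_pos, ← mul_sum]
  rfl

/-- The right logarithmic derivative of `g` with respect to the grading by length, i.e. the
solution `D` of `g * D = (w ↦ |w| g w)`. -/
noncomputable def logDeriv (g : List A → ℝ) (w : List A) : ℝ :=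
  w.length * g w - ∑ k : Fin w.length, g (w.take (k + 1)) * logDeriv g (w.drop (k + 1))
termination_by w.length
decreasing_by
  have := k.isLt
  simp
  omega

lemma logDeriv_eq (g : List A → ℝ) (w : List A) : logDeriv g w =
    w.length * g w - ∑ k ∈ range w.length, g (w.take (k + 1)) * logDeriv g (w.drop (k + 1)) := by
  rw [logDeriv, ← Fin.sum_univ_eq_sum_range
    (fun k => g (w.take (k + 1)) * logDeriv g (w.drop (k + 1)))]

lemma logDeriv_nil (g : List A → ℝ) : logDeriv g [] = 0 := by
  rw [logDeriv_eq]
  simp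

lemma conv_logDeriv {g : List A → ℝ} (hg : g [] = 1) (w : List A) :
    conv g (logDeriv g) w = w.length * g w := by
  rw [conv, sum_range_succ', List.take_zero, List.drop_zero, hg, one_mul, logDeriv_eq g w]
  ring

lemma shuffleSum_length_mul (g : List A → ℝ) (u v : List A) :
    shuffleSum u v (fun w => w.length * g w) = (u.length + v.length) * shuffleSum u v g := by
  rw [← shuffleSum_const_mul]
  exact shuffleSum_congr u v fun w hw => by rw [hw]; push_cast; rfl

lemma shuffleSum_logDeriv {n : ℕ} {g : List A → ℝ} (hg : IsCharacterBelow n g) (u v : List A)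
    (hu : u ≠ []) (hv : v ≠ []) (huv : u.length + v.length < n) :
    shuffleSum u v (logDeriv g) = 0 := by
  induction hN : u.length + v.length using Nat.strong_induction_on generalizing u v with
  | _ N ih =>
  subst hN
  have h := shuffleSum_conv_infinitesimal hu hv
    ⟨hg.nil, fun x y hxy => hg.mul x y (hxy.trans huv)⟩ (logDeriv_nil g)
    fun x y hx hy hxy => ih _ hxy x y hx hy (hxy.trans huv) rfl
  rw [show conv g (logDeriv g) = fun w => w.length * g w from funext (conv_logDeriv hg.nil),
    shuffleSum_length_mul, hg.mul u v huv] at h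
  linarith

/-- The canonical extension of a character below level `n` to level `n`, having vanishing
logarithmic derivative at level `n`. -/
noncomputable def gradedLift (n : ℕ) (g : List A → ℝ) (w : List A) : ℝ :=
  if w.length < n then g w
  else (n : ℝ)⁻¹ * conv g (fun x => if x.length < n then logDeriv g x else 0) w

lemma gradedLift_of_lt {n : ℕ} (g : List A → ℝ) {w : List A} (hw : w.length < n) :
    gradedLift n g w = g w := if_pos hw

lemma isCharacterBelow_gradedLift {n : ℕ} (hn : 0 < n) {g : List A → ℝ}
    (hg : IsCharacterBelow n g) : IsCharacterBelow (n + 1) (gradedLift n g) := by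
  refine ⟨by rw [gradedLift_of_lt g (by simpa), hg.nil], fun u v huv => ?_⟩
  by_cases hlt : u.length + v.length < n
  · exact (hg.congr hn fun w hw => gradedLift_of_lt g hw).mul u v hlt
  have hN : u.length + v.length = n := by omega
  rcases eq_or_ne u [] with rfl | hu
  · rw [shuffleSum_nil_left, gradedLift_of_lt g (w := []) (by simpa), hg.nil, one_mul]
  rcases eq_or_ne v [] with rfl | hv
  · rw [shuffleSum_nil_right, gradedLift_of_lt g (w := []) (by simpa), hg.nil, mul_one]
  have hul := List.length_pos_iff.2 hu
  have hvl := List.length_pos_iff.2 hv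
  set D : List A → ℝ := fun x => if x.length < n then logDeriv g x else 0 with hD
  have hc (w : List A) (hw : w.length < n) : conv g D w = w.length * g w := by
    rw [← conv_logDeriv hg.nil]
    exact conv_congr (fun _ _ => rfl) fun x hx => if_pos (by omega)
  have h := shuffleSum_conv_infinitesimal (D := D) hu hv (by rwa [hN])
    (by simp [hD, logDeriv_nil]) (fun x y hx hy hxy => by
      rw [shuffleSum_congr x y (h := logDeriv g) fun w hw => if_pos (by omega)]
      exact shuffleSum_logDeriv hg x y hx hy (by omega))
  have hz : shuffleSum u v D = 0 := by
    rw [← shuffleSum_zero u v]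
    exact shuffleSum_congr u v fun w hw => if_neg (by omega)
  rw [hz, hc u (by omega), hc v (by omega)] at h
  rw [shuffleSum_congr u v (g := gradedLift n g) (h := fun w => (n : ℝ)⁻¹ * conv g D w)
    fun w hw => if_neg (by omega), shuffleSum_const_mul, h,
    gradedLift_of_lt g (w := u) (by omega), gradedLift_of_lt g (w := v) (by omega), ← hN]
  have : ((u.length + v.length : ℕ) : ℝ) ≠ 0 := by positivity
  field_simp
  push_cast
  ring

lemma exists_bound_logDeriv (n m : ℕ) (hm : m ≤ n) {C : ℝ} (hC : 0 ≤ C) : ∃ K : ℝ, 0 ≤ K ∧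
    ∀ (g : List A → ℝ) (r : ℝ), 0 ≤ r → (∀ w : List A, w.length < n → |g w| ≤ C * r ^ w.length) →
      ∀ w : List A, w.length < m → |logDeriv g w| ≤ K * r ^ w.length := by
  induction m with
  | zero => exact ⟨0, le_rfl, fun _ _ _ _ w hw => absurd hw (by omega)⟩
  | succ m ih =>
    obtain ⟨K, hK, H⟩ := ih (by omega)
    refine ⟨m * C + m * (C * K), by positivity, fun g r hr hg w hw => ?_⟩
    have hwm : (w.length : ℝ) ≤ m := by exact_mod_cast (by omega : w.length ≤ m)
    rw [logDeriv_eq, add_mul]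
    refine (abs_sub _ _).trans (add_le_add ?_ ?_)
    · rw [abs_mul, Nat.abs_cast, mul_assoc]
      exact mul_le_mul hwm (hg w (by omega)) (abs_nonneg _) (by positivity)
    · refine (abs_sum_le_sum_abs _ _).trans ?_
      have : ∀ k ∈ range w.length, |g (w.take (k + 1)) * logDeriv g (w.drop (k + 1))| ≤
          C * K * r ^ w.length := by
        intro k hk
        rw [mem_range] at hk
        rw [abs_mul]
        refine (mul_le_mul (hg _ (by simp; omega)) (H g r hr hg _ (by simp; omega))
          (abs_nonneg _) (by positivity)).trans_eq ?_
        rw [mul_mul_mul_comm, ← pow_add]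
        congr 2
        simp
        omega
      refine (sum_le_card_nsmul _ _ _ this).trans ?_
      rw [card_range, nsmul_eq_mul, mul_assoc (m : ℝ)]
      exact mul_le_mul_of_nonneg_right hwm (by positivity)

lemma exists_bound_gradedLift (n : ℕ) {C : ℝ} (hC : 0 ≤ C) : ∃ K : ℝ, 0 ≤ K ∧
    ∀ (g : List A → ℝ) (r : ℝ), 0 ≤ r → (∀ w : List A, w.length < n → |g w| ≤ C * r ^ w.length) →
      ∀ w : List A, w.length = n → |gradedLift n g w| ≤ K * r ^ n := by
  obtain ⟨K, hK, H⟩ := exists_bound_logDeriv (A := A) n n le_rfl hC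
  refine ⟨(n : ℝ)⁻¹ * ((n + 1) * (C * K)), by positivity, fun g r hr hg w hw => ?_⟩
  rw [gradedLift, if_neg (by omega), abs_mul, abs_of_nonneg (by positivity), mul_assoc]
  refine mul_le_mul_of_nonneg_left ((abs_sum_le_sum_abs _ _).trans ?_) (by positivity)
  have hCK : 0 ≤ C * K * r ^ n := by positivity
  have : ∀ k ∈ range (w.length + 1), |g (w.take k) *
      (if (w.drop k).length < n then logDeriv g (w.drop k) else 0)| ≤ C * K * r ^ n := by
    intro k hk
    rw [mem_range] at hk
    by_cases hk0 : (w.drop k).length < n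
    · rw [if_pos hk0]
      by_cases hkn : k = w.length
      · subst hkn
        simpa [logDeriv_nil] using hCK
      rw [abs_mul]
      refine (mul_le_mul (hg _ (by simp; omega)) (H g r hr hg _ hk0)
        (abs_nonneg _) (by positivity)).trans_eq ?_
      rw [mul_mul_mul_comm, ← pow_add]
      congr 2
      simp
      omega
    · rw [if_neg hk0]
      simpa using hCK
  refine (sum_le_card_nsmul _ _ _ this).trans_eq ?_
  rw [card_range, nsmul_eq_mul, hw]
  push_cast
  ring

lemma abs_conv_sub_le {n : ℕ} {g h : List A → ℝ} {C r : ℝ} (hr : 0 ≤ r)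
    (hg1 : g [] = 1) (hh1 : h [] = 1)
    (hg : ∀ w : List A, w.length < n → |g w| ≤ C * r ^ w.length)
    (hh : ∀ w : List A, w.length < n → |h w| ≤ C * r ^ w.length) (w : List A)
    (hw : w.length = n) (hn : 0 < n) :
    |conv g h w - g w - h w| ≤ n * C ^ 2 * r ^ n := by
  have hC : 0 ≤ C := by simpa using (abs_nonneg _).trans (hg [] hn)
  rw [conv_eq_proper g h w (List.length_pos_iff.1 (by omega)) hg1 hh1, add_sub_right_comm,
    add_sub_cancel_left, add_sub_cancel_left]
  refine (abs_sum_le_sum_abs _ _).trans ?_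
  have : ∀ k ∈ range (w.length - 1), |g (w.take (k + 1)) * h (w.drop (k + 1))| ≤
      C ^ 2 * r ^ n := by
    intro k hk
    rw [mem_range] at hk
    rw [abs_mul]
    refine (mul_le_mul (hg _ (by simp; omega)) (hh _ (by simp; omega))
      (abs_nonneg _) (by positivity)).trans_eq ?_
    rw [mul_mul_mul_comm, ← pow_add, sq]
    congr 2
    simp
    omega
  refine (sum_le_card_nsmul _ _ _ this).trans ?_
  rw [card_range, nsmul_eq_mul, mul_assoc (n : ℝ)]
  exact mul_le_mul_of_nonneg_right (by exact_mod_cast (by omega)) (by positivity)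

/-- The word obtained by placing the letters `U 0, U 1, …` at the positions of `S` and
`V 0, V 1, …` at the remaining positions. -/
def interleave {M : ℕ} (S : Finset (Fin M)) (U V : ℕ → A) (m : Fin M) : A :=
  if m ∈ S then U #{x ∈ S | x < m} else V #{x ∈ Sᶜ | x < m}

lemma card_filter_lt_eq_symm {M n : ℕ} (S : Finset (Fin M)) (hS : #S = n) (m : Fin M)
    (hm : m ∈ S) : #{x ∈ S | x < m} = ((S.orderIsoOfFin hS).symm ⟨m, hm⟩).1 := by
  set i := (S.orderIsoOfFin hS).symm ⟨m, hm⟩ with hi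
  have him : S.orderEmbOfFin hS i = m := by
    rw [← coe_orderIsoOfFin_apply, hi, OrderIso.apply_symm_apply]
  have : ({x ∈ S | x < m} : Finset (Fin M)) = (Iio i).map (S.orderEmbOfFin hS).toEmbedding := by
    ext x
    simp only [mem_filter, mem_map, mem_Iio]
    constructor
    · rintro ⟨hx, hlt⟩
      refine ⟨(S.orderIsoOfFin hS).symm ⟨x, hx⟩, ?_, ?_⟩
      · rw [hi, OrderIso.lt_iff_lt]; exact hlt
      · change S.orderEmbOfFin hS _ = x
        rw [← coe_orderIsoOfFin_apply, OrderIso.apply_symm_apply]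
    · rintro ⟨j, hj, rfl⟩
      refine ⟨orderEmbOfFin_mem S hS j, ?_⟩
      rw [← him]
      exact (OrderEmbedding.lt_iff_lt _).2 hj
  rw [this, card_map, Fin.card_Iio]

lemma shuffleWord_eq_interleave {d n₁ n₂ : ℕ} (u : Fin n₁ → Fin d) (v : Fin n₂ → Fin d)
    (U V : ℕ → Fin d) (hU : ∀ j : Fin n₁, U j = u j) (hV : ∀ j : Fin n₂, V j = v j)
    (S : Finset (Fin (n₁ + n₂))) (hS : #S = n₁) :
    shuffleWord u v S hS = interleave S U V := by
  funext m
  unfold shuffleWord interleave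
  by_cases hm : m ∈ S
  · rw [dif_pos hm, if_pos hm, card_filter_lt_eq_symm S hS m hm, hU]
  · rw [dif_neg hm, if_neg hm, card_filter_lt_eq_symm Sᶜ _ m (mem_compl.2 hm), hV]

lemma interleave_insert_zero {M : ℕ} (S : Finset (Fin M)) (U V : ℕ → A) :
    List.ofFn (interleave (insert 0 (S.map (Fin.succEmb M))) U V) =
      U 0 :: List.ofFn (interleave S (fun j => U (j + 1)) V) := by
  rw [List.ofFn_succ]
  congr 1
  · simp [interleave]
  · congr 1
    funext m
    have h1 : ({x ∈ insert 0 (S.map (Fin.succEmb M)) | x < m.succ} : Finset (Fin (M + 1))) =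
        insert 0 (({x ∈ S | x < m} : Finset (Fin M)).map (Fin.succEmb M)) := by
      ext x
      refine Fin.cases ?_ (fun y => ?_) x <;> simp [Fin.succ_ne_zero]
    have h2 : ({x ∈ (insert 0 (S.map (Fin.succEmb M)))ᶜ | x < m.succ} : Finset (Fin (M + 1))) =
        ({x ∈ Sᶜ | x < m} : Finset (Fin M)).map (Fin.succEmb M) := by
      ext x
      refine Fin.cases ?_ (fun y => ?_) x <;> simp [Fin.succ_ne_zero]
    simp only [interleave]
    rw [h1, h2, card_insert_of_notMem (by simp [Fin.succ_ne_zero]), card_map, card_map]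
    simp [Fin.succ_ne_zero]

lemma interleave_map_succ {M : ℕ} (S : Finset (Fin M)) (U V : ℕ → A) :
    List.ofFn (interleave (S.map (Fin.succEmb M)) U V) =
      V 0 :: List.ofFn (interleave S U (fun j => V (j + 1))) := by
  rw [List.ofFn_succ]
  congr 1
  · simp [interleave, Fin.succ_ne_zero]
  · congr 1
    funext m
    have h1 : ({x ∈ S.map (Fin.succEmb M) | x < m.succ} : Finset (Fin (M + 1))) =
        ({x ∈ S | x < m} : Finset (Fin M)).map (Fin.succEmb M) := by
      ext x
      refine Fin.cases ?_ (fun y => ?_) x <;> simp [Fin.succ_ne_zero]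
    have h2 : ({x ∈ (S.map (Fin.succEmb M))ᶜ | x < m.succ} : Finset (Fin (M + 1))) =
        insert 0 (({x ∈ Sᶜ | x < m} : Finset (Fin M)).map (Fin.succEmb M)) := by
      ext x
      refine Fin.cases ?_ (fun y => ?_) x <;> simp [Fin.succ_ne_zero]
    simp only [interleave]
    rw [h1, h2, card_insert_of_notMem (by simp [Fin.succ_ne_zero]), card_map, card_map]
    simp

lemma sum_powersetCard_succ {M k : ℕ} (f : Finset (Fin (M + 1)) → ℝ) :
    ∑ S ∈ powersetCard (k + 1) univ, f S =
      ∑ S ∈ powersetCard k univ, f (insert 0 (S.map (Fin.succEmb M))) +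
      ∑ S ∈ powersetCard (k + 1) univ, f (S.map (Fin.succEmb M)) := by
  have hu : (univ : Finset (Fin (M + 1))) = insert 0 (univ.map (Fin.succEmb M)) := by
    rw [Fin.univ_succ, cons_eq_insert]
    congr 1
  have h0 : (0 : Fin (M + 1)) ∉ (univ : Finset (Fin M)).map (Fin.succEmb M) := by
    simp [Fin.succ_ne_zero]
  rw [hu, powersetCard_succ_insert h0, sum_union, add_comm]
  · congr 1
    · rw [sum_image, powersetCard_map, sum_map]
      · rfl
      · intro S hS S' hS' h
        have hS0 : (0 : Fin (M + 1)) ∉ S := fun h => h0 ((mem_powersetCard.1 hS).1 h)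
        have hS0' : (0 : Fin (M + 1)) ∉ S' := fun h => h0 ((mem_powersetCard.1 hS').1 h)
        rw [← erase_insert hS0, h, erase_insert hS0']
    · rw [powersetCard_map, sum_map]
      rfl
  · rw [disjoint_left]
    intro S hS hS'
    obtain ⟨S'', -, rfl⟩ := mem_image.1 hS'
    exact h0 ((mem_powersetCard.1 hS).1 (mem_insert_self _ _))

lemma sum_interleave (M n₁ n₂ : ℕ) (hM : n₁ + n₂ = M) (U V : ℕ → A) (g : List A → ℝ) :
    ∑ S ∈ powersetCard n₁ (univ : Finset (Fin M)), g (List.ofFn (interleave S U V)) =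
      shuffleSum (List.ofFn fun j : Fin n₁ => U j) (List.ofFn fun j : Fin n₂ => V j) g := by
  induction M generalizing n₁ n₂ U V g with
  | zero =>
    obtain rfl : n₁ = 0 := by omega
    obtain rfl : n₂ = 0 := by omega
    simp
  | succ M ih =>
    rcases n₁ with _ | n₁
    · obtain rfl : n₂ = M + 1 := by omega
      simp only [powersetCard_zero, sum_singleton, List.ofFn_zero, shuffleSum_nil_left]
      have := ih 0 M (by omega) U (fun j => V (j + 1)) (fun w => g (V 0 :: w))
      simp only [powersetCard_zero, sum_singleton, List.ofFn_zero, shuffleSum_nil_left] at this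
      rw [List.ofFn_succ (f := fun j : Fin (M + 1) => V j)]
      change _ = g (V 0 :: List.ofFn fun j : Fin M => V (j + 1))
      rw [← this, ← interleave_map_succ, map_empty]
    · rw [sum_powersetCard_succ]
      simp only [interleave_insert_zero, interleave_map_succ]
      rw [ih n₁ n₂ (by omega) (fun j => U (j + 1)) V (fun w => g (U 0 :: w))]
      rcases n₂ with _ | n₂
      · rw [powersetCard_eq_empty.2 (by simp; omega)]
        simp [List.ofFn_succ]
      · rw [ih (n₁ + 1) n₂ (by omega) U (fun j => V (j + 1)) (fun w => g (V 0 :: w))]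
        simp only [List.ofFn_succ, shuffleSum_cons_cons, Fin.val_zero, Fin.val_succ]

lemma sum_shuffleWord {d n₁ n₂ : ℕ} (hd : 1 ≤ d) (u : Fin n₁ → Fin d) (v : Fin n₂ → Fin d)
    (g : List (Fin d) → ℝ) :
    ∑ S : {S : Finset (Fin (n₁ + n₂)) // #S = n₁}, g (List.ofFn (shuffleWord u v S.1 S.2)) =
      shuffleSum (List.ofFn u) (List.ofFn v) g := by
  let U : ℕ → Fin d := fun j => if h : j < n₁ then u ⟨j, h⟩ else ⟨0, hd⟩
  let V : ℕ → Fin d := fun j => if h : j < n₂ then v ⟨j, h⟩ else ⟨0, hd⟩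
  have hU (j : Fin n₁) : U j = u j := by simp [U]
  have hV (j : Fin n₂) : V j = v j := by simp [V]
  have h := sum_interleave (n₁ + n₂) n₁ n₂ rfl U V g
  simp only [hU, hV] at h
  rw [← h]
  simp only [shuffleWord_eq_interleave u v U V hU hV]
  exact (sum_subtype (powersetCard n₁ univ) (fun S => by simp [mem_powersetCard])
    (fun S => g (List.ofFn (interleave S U V)))).symm

/-- Extension by zero of a function on words of length `n` to all words. -/
def ofLevel {n : ℕ} (φ : List.Vector A n → ℝ) (w : List A) : ℝ :=
  if h : w.length = n then φ ⟨w, h⟩ else 0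

lemma ofLevel_smul_add {n : ℕ} (c : ℝ) (φ ψ : List.Vector A n → ℝ) :
    ofLevel (c • φ + ψ) = fun w => c * ofLevel φ w + ofLevel ψ w := by
  funext w
  by_cases h : w.length = n
  · simp only [ofLevel, h, dif_pos]
    rfl
  · simp [ofLevel, h]

lemma ofLevel_zero {n : ℕ} : ofLevel (0 : List.Vector A n → ℝ) = fun _ => 0 := by
  funext w
  simp only [ofLevel]
  split_ifs <;> rfl

lemma ofLevel_restrict {n : ℕ} (g : List A → ℝ) {w : List A} (hw : w.length = n) :
    ofLevel (fun x : List.Vector A n => g x.1) w = g w := dif_pos hw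

variable (A) in
/-- Functions on words of length `n` that vanish on all proper shuffle products. -/
def infinitesimal (n : ℕ) : Submodule ℝ (List.Vector A n → ℝ) where
  carrier := {φ | ∀ u v : List A, u ≠ [] → v ≠ [] → u.length + v.length = n →
    shuffleSum u v (ofLevel φ) = 0}
  zero_mem' u v _ _ _ := by
    rw [ofLevel_zero, shuffleSum_zero]
  add_mem' {φ ψ} hφ hψ u v hu hv huv := by
    rw [← one_smul ℝ φ, ofLevel_smul_add, shuffleSum_linear, hφ u v hu hv huv,
      hψ u v hu hv huv]
    simp
  smul_mem' c φ hφ u v hu hv huv := by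
    rw [← add_zero (c • φ), ofLevel_smul_add, shuffleSum_linear, hφ u v hu hv huv, mul_zero,
      ofLevel_zero, shuffleSum_zero, add_zero]

/-- The values at level `n` of the increments `Y t * (Y s)⁻¹`, given the lower level increments
`X t s`. -/
noncomputable def extend (n : ℕ) (X : ℝ → ℝ → List A → ℝ) (Y : ℝ → List A → ℝ) (t s : ℝ)
    (w : List A) : ℝ :=
  if w.length < n then X t s w else X t s w + Y t w - conv (X t s) (Y s) w

section extend

variable {n : ℕ} {X : ℝ → ℝ → List A → ℝ} {Y : ℝ → List A → ℝ}

lemma extend_of_lt (Y : ℝ → List A → ℝ) (t s : ℝ) {w : List A} (hw : w.length < n) :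
    extend n X Y t s w = X t s w := if_pos hw

lemma conv_extend (hn : 0 < n) (hX : ∀ t s, X t s [] = 1) (hY : ∀ t, Y t [] = 1)
    (hXY : ∀ t s w, w.length < n → conv (X t s) (Y s) w = Y t w) (t s : ℝ) {w : List A}
    (hw : w.length ≤ n) : conv (extend n X Y t s) (Y s) w = Y t w := by
  by_cases h : w.length < n
  · rw [← hXY t s w h]
    exact conv_congr (fun x hx => extend_of_lt Y t s (by omega)) fun _ _ => rfl
  · rw [conv_update (g := X t s) (h := Y s) (List.length_pos_iff.1 (by omega))
      (fun x hx => extend_of_lt Y t s (by omega)) (fun _ _ => rfl) (hX t s) (hY s),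
      extend, if_neg h]
    ring

lemma isCharacterBelow_extend (hn : 0 < n) (hX : ∀ t s, IsCharacterBelow n (X t s))
    (hY : ∀ t, IsCharacterBelow (n + 1) (Y t))
    (hXY : ∀ t s w, w.length < n → conv (X t s) (Y s) w = Y t w) (t s : ℝ) :
    IsCharacterBelow (n + 1) (extend n X Y t s) := by
  have h := (hX t s).congr hn fun w hw => extend_of_lt Y t s hw
  refine ⟨h.nil, fun u v huv => ?_⟩
  by_cases hlt : u.length + v.length < n
  · exact h.mul u v hlt
  have hc {w : List A} (hw : w.length ≤ n) :=
    conv_extend hn (fun t s => (hX t s).nil) (fun t => (hY t).nil) hXY t s hw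
  have := shuffleSum_conv_defect hn h ⟨(hY s).nil, fun x y hxy => (hY s).mul x y (by omega)⟩ u v
    (by omega)
  rw [shuffleSum_congr u v (fun w hw => hc (w := w) (by omega)), hc (w := u) (by omega),
    hc (w := v) (by omega), (hY t).mul u v huv, (hY s).mul u v huv] at this
  linarith

lemma extend_chen (hn : 0 < n) (hX : ∀ t s, X t s [] = 1) (hY : ∀ t, Y t [] = 1)
    (hchen : ∀ t u s w, w.length < n → conv (X t u) (X u s) w = X t s w)
    (hXY : ∀ t s w, w.length < n → conv (X t s) (Y s) w = Y t w) (t u s : ℝ) {w : List A}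
    (hw : w.length ≤ n) : conv (extend n X Y t u) (extend n X Y u s) w = extend n X Y t s w := by
  have hlow (x : List A) (hx : x.length < n) :
      conv (extend n X Y t u) (extend n X Y u s) x = extend n X Y t s x := by
    rw [extend_of_lt Y t s hx, ← hchen t u s x hx]
    exact conv_congr (fun y hy => extend_of_lt Y t u (by omega))
      fun y hy => extend_of_lt Y u s (by omega)
  by_cases h : w.length < n
  · exact hlow w h
  have e1 : conv (conv (extend n X Y t u) (extend n X Y u s)) (Y s) w = Y t w := by
    rw [conv_assoc, ← conv_extend hn hX hY hXY t u hw]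
    exact conv_congr (fun _ _ => rfl) fun x hx => conv_extend hn hX hY hXY u s (by omega)
  rw [conv_update (g := extend n X Y t s) (h := Y s) (List.length_pos_iff.1 (by omega))
    (fun x hx => hlow x (by omega)) (fun _ _ => rfl)
    (by rw [extend_of_lt Y t s (by simpa), hX]) (hY s), conv_extend hn hX hY hXY t s hw] at e1
  linarith

end extend

/-- `X` is an `α`-Hölder geometric rough path over `γ` on `[0,1]`, up to levels less than `n`. -/
structure IsRoughBelow (n : ℕ) (α : ℝ) (γ : ℝ → A → ℝ) (X : ℝ → ℝ → List A → ℝ) : Prop where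
  character : ∀ t s, IsCharacterBelow n (X t s)
  chen : ∀ t u s w, w.length < n → conv (X t u) (X u s) w = X t s w
  bound : ∃ C : ℝ, ∀ s t, 0 ≤ s → s ≤ t → t ≤ 1 → ∀ w : List A, w.length < n →
    |X t s w| ≤ C * ((t - s) ^ α) ^ w.length
  level_one : ∀ t s a, X t s [a] = γ t a - γ s a

lemma IsRoughBelow.exists_succ [Fintype A] {n : ℕ} (hn : 2 ≤ n) {α : ℝ} (hα : 0 < α)
    (hαn : n * α < 1) {γ : ℝ → A → ℝ} {X : ℝ → ℝ → List A → ℝ} (hX : IsRoughBelow n α γ X) :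
    ∃ X' : ℝ → ℝ → List A → ℝ, IsRoughBelow (n + 1) α γ X' := by
  have hn0 : 0 < n := by omega
  obtain ⟨C, hC⟩ := hX.bound
  have hC0 : 0 ≤ C := by
    simpa using (abs_nonneg _).trans (hC 0 1 le_rfl zero_le_one le_rfl [] hn0)
  have hnil (t s : ℝ) : X t s [] = 1 := (hX.character t s).nil
  set Y : ℝ → List A → ℝ := fun t => gradedLift n (X t 0) with hYdef
  have hYlow (t : ℝ) (w : List A) (hw : w.length < n) : Y t w = X t 0 w := gradedLift_of_lt _ hw
  have hY (t : ℝ) : IsCharacterBelow (n + 1) (Y t) :=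
    isCharacterBelow_gradedLift hn0 (hX.character t 0)
  have hXY (t s : ℝ) (w : List A) (hw : w.length < n) : conv (X t s) (Y s) w = Y t w := by
    rw [hYlow t w hw, ← hX.chen t s 0 w hw]
    exact conv_congr (fun _ _ => rfl) fun x hx => hYlow s x (by omega)
  have hA := isCharacterBelow_extend hn0 hX.character hY hXY
  have hAchen (t u s : ℝ) {w : List A} (hw : w.length ≤ n) :=
    extend_chen hn0 hnil (fun t => (hY t).nil) hX.chen hXY t u s hw
  have hF (t s : ℝ) := isCharacterBelow_gradedLift hn0 (hX.character t s)
  have hE (t s : ℝ) : (fun x : List.Vector A n =>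
      extend n X Y t s x.1 - gradedLift n (X t s) x.1) ∈ infinitesimal A n := by
    intro u v hu hv huv
    have hul := List.length_pos_iff.2 hu
    have hvl := List.length_pos_iff.2 hv
    rw [shuffleSum_congr u v
      (h := fun w => (-1) * gradedLift n (X t s) w + extend n X Y t s w) (fun w hw => by
        rw [ofLevel_restrict (fun w => extend n X Y t s w - gradedLift n (X t s) w) (by omega)]
        ring),
      shuffleSum_linear, (hA t s).mul u v (by omega), (hF t s).mul u v (by omega),
      extend_of_lt Y t s (w := u) (by omega), extend_of_lt Y t s (w := v) (by omega),
      gradedLift_of_lt (X t s) (w := u) (by omega), gradedLift_of_lt (X t s) (w := v) (by omega)]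
    ring
  let E : ℝ → ℝ → infinitesimal A n := fun t s => ⟨_, hE t s⟩
  obtain ⟨K, hK, hFb⟩ := exists_bound_gradedLift (A := A) n hC0
  have hrn (s t : ℝ) (hst : s ≤ t) : ((t - s) ^ α) ^ n = (t - s) ^ (n * α) := by
    rw [← Real.rpow_natCast, ← Real.rpow_mul (by linarith), mul_comm]
  have hmono (s t s' t' : ℝ) (h0 : 0 ≤ s) (hs : s ≤ s') (hst : s' ≤ t') (ht : t' ≤ t)
      (h1 : t ≤ 1) (w : List A) (hw : w.length < n) :
      |X t' s' w| ≤ C * ((t - s) ^ α) ^ w.length := by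
    refine (hC s' t' (h0.trans hs) hst (ht.trans h1) w hw).trans ?_
    have : (t' - s') ^ α ≤ (t - s) ^ α := Real.rpow_le_rpow (by linarith) (by linarith) hα.le
    have h0 : 0 ≤ (t' - s') ^ α := Real.rpow_nonneg (by linarith) _
    gcongr
  have hδ (s u t : ℝ) (h0 : 0 ≤ s) (hsu : s ≤ u) (hut : u ≤ t) (h1 : t ≤ 1) :
      ‖E t s - E t u - E u s‖ ≤ (n * C ^ 2 + 3 * K) * (t - s) ^ (n * α) := by
    have hr : 0 ≤ (t - s) ^ α := Real.rpow_nonneg (by linarith) _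
    rw [← hrn s t (hsu.trans hut), ← Submodule.norm_coe, pi_norm_le_iff_of_nonneg (by positivity)]
    rintro ⟨w, hw⟩
    have b1 := abs_conv_sub_le hr (hA t u).nil (hA u s).nil
      (fun x hx => by
        rw [extend_of_lt Y t u hx]
        exact hmono s t u t h0 hsu hut le_rfl h1 x hx)
      (fun x hx => by
        rw [extend_of_lt Y u s hx]
        exact hmono s t s u h0 le_rfl hsu hut h1 x hx) w hw hn0
    rw [hAchen t u s hw.le] at b1
    have b2 := hFb (X t s) _ hr (hmono s t s t h0 le_rfl (hsu.trans hut) le_rfl h1) w hw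
    have b3 := hFb (X t u) _ hr (hmono s t u t h0 hsu hut le_rfl h1) w hw
    have b4 := hFb (X u s) _ hr (hmono s t s u h0 le_rfl hsu hut h1) w hw
    change |(extend n X Y t s w - gradedLift n (X t s) w) -
      (extend n X Y t u w - gradedLift n (X t u) w) -
      (extend n X Y u s w - gradedLift n (X u s) w)| ≤ _
    rw [abs_le] at *
    constructor <;> linarith
  have : CompleteSpace (infinitesimal A n) := FiniteDimensional.complete ℝ _
  obtain ⟨f, K', hf⟩ := exists_primitive_of_coboundary_bound
    (by positivity : 0 < n * α) hαn hδ
  set Z : ℝ → List A → ℝ := fun t w => Y t w - ofLevel (f t).1 w with hZdef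
  have hZlow (t : ℝ) (w : List A) (hw : w.length < n) : Z t w = Y t w := by
    simp [hZdef, ofLevel, hw.ne]
  have hZ (t : ℝ) : IsCharacterBelow (n + 1) (Z t) := by
    have hnilZ : Z t [] = 1 := by rw [hZlow t [] (by simpa), (hY t).nil]
    refine ⟨hnilZ, fun u v huv => ?_⟩
    rcases eq_or_ne u [] with rfl | hu
    · rw [shuffleSum_nil_left, hnilZ, one_mul]
    rcases eq_or_ne v [] with rfl | hv
    · rw [shuffleSum_nil_right, hnilZ, mul_one]
    have hul := List.length_pos_iff.2 hu
    have hvl := List.length_pos_iff.2 hv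
    rw [hZlow t u (by omega), hZlow t v (by omega), ← (hY t).mul u v huv]
    by_cases hlt : u.length + v.length < n
    · exact shuffleSum_congr u v fun w hw => hZlow t w (by omega)
    · rw [shuffleSum_congr u v (g := Z t) (h := fun w => (-1) * ofLevel (f t).1 w + Y t w)
        (fun w _ => by simp only [hZdef]; ring), shuffleSum_linear,
        (f t).2 u v hu hv (by omega)]
      ring
  have hXZ (t s : ℝ) (w : List A) (hw : w.length < n) : conv (X t s) (Z s) w = Z t w := by
    rw [hZlow t w hw, ← hXY t s w hw]
    exact conv_congr (fun _ _ => rfl) fun x hx => hZlow s x (by omega)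
  refine ⟨extend n X Z, isCharacterBelow_extend hn0 hX.character hZ hXZ,
    fun t u s w hw => extend_chen hn0 hnil (fun t => (hZ t).nil) hX.chen hXZ t u s (by omega),
    ⟨max C (K + K'), fun s t h0 hst h1 w hw => ?_⟩, fun t s a => ?_⟩
  · have hr : 0 ≤ (t - s) ^ α := Real.rpow_nonneg (by linarith) _
    by_cases hlt : w.length < n
    · rw [extend_of_lt Z t s hlt]
      refine (hC s t h0 hst h1 w hlt).trans ?_
      exact mul_le_mul_of_nonneg_right (le_max_left _ _) (by positivity)
    · have hwn : w.length = n := by omega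
      have e : extend n X Z t s w = gradedLift n (X t s) w +
          (E t s - (f t - f s)).1 ⟨w, hwn⟩ := by
        have h2 := conv_update (g := X t s) (g' := X t s) (h := Y s) (h' := Z s) (w := w)
          (List.length_pos_iff.1 (by omega)) (fun _ _ => rfl)
          (fun x hx => hZlow s x (by omega)) (hnil t s) (hY s).nil
        have h3 (t : ℝ) : Z t w = Y t w - (f t).1 ⟨w, hwn⟩ := by
          simp only [hZdef, ofLevel, hwn, dif_pos]
        rw [extend, if_neg hlt, h2, h3, h3]
        change _ = _ + ((extend n X Y t s w - gradedLift n (X t s) w) -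
          ((f t).1 ⟨w, hwn⟩ - (f s).1 ⟨w, hwn⟩))
        rw [extend, if_neg hlt]
        ring
      have b1 := hFb (X t s) _ hr (hmono s t s t h0 le_rfl hst le_rfl h1) w hwn
      have b2 := (norm_le_pi_norm (E t s - (f t - f s)).1 ⟨w, hwn⟩).trans (hf s t h0 hst h1)
      rw [← hrn s t hst, Real.norm_eq_abs] at b2
      rw [e, hwn]
      refine (abs_add_le _ _).trans ((add_le_add b1 b2).trans ?_)
      rw [← add_mul]
      exact mul_le_mul_of_nonneg_right (le_max_right _ _) (by positivity)
  · rw [extend_of_lt Z t s (by simpa), hX.level_one]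

/-- Existence of a geometric rough path over an `α`-Hölder path, up to any level `n` with
`n * α < 1`. -/
lemma exists_isRoughBelow [Fintype A] {α : ℝ} (hα : 0 < α) {γ : ℝ → A → ℝ} {K : ℝ}
    (hγ : ∀ s t a, |γ t a - γ s a| ≤ K * |t - s| ^ α) (n : ℕ) (hαn : (n + 1 : ℕ) * α < 1) :
    ∃ X : ℝ → ℝ → List A → ℝ, IsRoughBelow (n + 2) α γ X := by
  induction n with
  | zero =>
    let X : ℝ → ℝ → List A → ℝ := fun t s w =>
      match w with
      | [] => 1
      | a :: _ => γ t a - γ s a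
    refine ⟨X, fun t s => ⟨rfl, fun u v huv => ?_⟩, fun t u s w hw => ?_,
      ⟨max 1 K, fun s t h0 hst h1 w hw => ?_⟩, fun _ _ _ => rfl⟩
    · rcases u with _ | ⟨a, u⟩
      · simp [X]
      · rcases v with _ | ⟨b, v⟩
        · simp [X]
        · simp at huv; omega
    · match w, hw with
      | [], _ => simp [conv_nil, X]
      | [a], _ => simp [conv_cons, conv_nil, X]
      | a :: b :: w, hw => simp at hw
    · match w, hw with
      | [], _ => simp [X]
      | [a], _ =>
        have := hγ s t a
        rw [abs_of_nonneg (sub_nonneg.2 hst)] at this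
        simp only [X, List.length_singleton, pow_one]
        exact this.trans (mul_le_mul_of_nonneg_right (le_max_right _ _)
          (Real.rpow_nonneg (by linarith) _))
      | a :: b :: w, hw => simp at hw
  | succ n ih =>
    obtain ⟨X, hX⟩ := ih (by push_cast at hαn ⊢; linarith)
    exact hX.exists_succ (by omega) hα hαn

lemma abs_rpow_add_le {α : ℝ} (hα0 : 0 ≤ α) (hα1 : α ≤ 1) (x y z : ℝ) :
    |x - z| ^ α ≤ |x - y| ^ α + |y - z| ^ α :=
  (Real.rpow_le_rpow (abs_nonneg _) (abs_sub_le x y z) hα0).trans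
    (Real.rpow_add_le_add_rpow (abs_nonneg _) (abs_nonneg _) hα0 hα1)

/-- McShane extension of a Hölder function given along a parametrization `v`. -/
lemma exists_holder_extension {ι : Type*} [Nonempty ι] {α : ℝ} (hα0 : 0 < α) (hα1 : α ≤ 1)
    (v : ι → ℝ) (φ : ι → ℝ) {K : ℝ} (hK : 0 ≤ K)
    (h : ∀ a b, |φ a - φ b| ≤ K * |v a - v b| ^ α) :
    ∃ f : ℝ → ℝ, (∀ x y, |f x - f y| ≤ K * |x - y| ^ α) ∧ ∀ a, f (v a) = φ a := by
  have hbdd (x : ℝ) : BddBelow (Set.range fun a => φ a + K * |x - v a| ^ α) := by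
    obtain ⟨a₀⟩ := ‹Nonempty ι›
    refine ⟨φ a₀ - K * |v a₀ - x| ^ α, ?_⟩
    rintro _ ⟨a, rfl⟩
    have h1 := (le_abs_self _).trans (h a₀ a)
    have h2 := mul_le_mul_of_nonneg_left (abs_rpow_add_le hα0.le hα1 (v a₀) x (v a)) hK
    simp only
    linarith
  have hle (x y : ℝ) : (⨅ a, (φ a + K * |x - v a| ^ α)) ≤
      (⨅ a, (φ a + K * |y - v a| ^ α)) + K * |x - y| ^ α := by
    rw [← sub_le_iff_le_add]
    refine le_ciInf fun a => ?_
    have h1 := ciInf_le (hbdd x) a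
    have h2 := mul_le_mul_of_nonneg_left (abs_rpow_add_le hα0.le hα1 x y (v a)) hK
    linarith
  refine ⟨fun x => ⨅ a, (φ a + K * |x - v a| ^ α), fun x y => ?_, fun a => ?_⟩
  · have h1 := hle x y
    have h2 := hle y x
    rw [abs_sub_comm y x] at h2
    rw [abs_le]
    constructor <;> linarith
  · refine le_antisymm ((ciInf_le (hbdd _) a).trans ?_) (le_ciInf fun b => ?_)
    · simp [Real.zero_rpow hα0.ne']
    · have := (le_abs_self _).trans (h a b)
      linarith

/-- A path of finite `p`-variation admits a control of the form `V t - V s`. -/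
lemma exists_variation_control {E : Type*} [SeminormedAddCommGroup E] {p T : ℝ}
    (Γ : ℝ → E) {C : ℝ}
    (hC : ∀ (m : ℕ) (τ : Fin (m + 1) → ℝ), Monotone τ → τ 0 = 0 → τ (Fin.last m) = T →
      ∑ j : Fin m, ‖Γ (τ j.succ) - Γ (τ j.castSucc)‖ ^ p ≤ C) :
    ∃ V : ℝ → ℝ, (∀ t, 0 ≤ t → t ≤ T → 0 ≤ V t ∧ V t ≤ C) ∧
      ∀ s t, 0 ≤ s → s ≤ t → t ≤ T → ‖Γ t - Γ s‖ ^ p ≤ V t - V s := by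
  let P : ℝ → Set ℝ := fun t => {c | ∃ (m : ℕ) (τ : Fin (m + 1) → ℝ), Monotone τ ∧ τ 0 = 0 ∧
    τ (Fin.last m) = t ∧ ∑ j : Fin m, ‖Γ (τ j.succ) - Γ (τ j.castSucc)‖ ^ p = c}
  have hP0 : (0 : ℝ) ∈ P 0 := ⟨0, fun _ => 0, fun _ _ _ => le_rfl, rfl, rfl, by simp⟩
  have happ (s t c : ℝ) (hst : s ≤ t) (hc : c ∈ P s) : c + ‖Γ t - Γ s‖ ^ p ∈ P t := by
    obtain ⟨m, τ, hτ, h0, hl, rfl⟩ := hc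
    refine ⟨m + 1, Fin.snoc (α := fun _ => ℝ) τ t, ?_, ?_, Fin.snoc_last _ _, ?_⟩
    · refine Fin.monotone_iff_le_succ.2 fun i => ?_
      induction i using Fin.lastCases with
      | last =>
        rw [Fin.succ_last, Fin.snoc_last, Fin.snoc_castSucc, hl]
        exact hst
      | cast i =>
        rw [Fin.succ_castSucc, Fin.snoc_castSucc, Fin.snoc_castSucc]
        exact hτ (Fin.castSucc_le_succ i)
    · rw [← Fin.castSucc_zero, Fin.snoc_castSucc, h0]
    · rw [Fin.sum_univ_castSucc]
      simp only [Fin.succ_castSucc, Fin.snoc_castSucc, Fin.succ_last, Fin.snoc_last, hl]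
  have hbound (t c : ℝ) (ht : t ≤ T) (hc : c ∈ P t) : c ≤ C := by
    obtain ⟨m, τ, hτ, h0, hl, hs⟩ := happ t T c ht hc
    have := hC m τ hτ h0 hl
    have : 0 ≤ ‖Γ T - Γ t‖ ^ p := by positivity
    linarith
  have hbdd (t : ℝ) (ht : t ≤ T) : BddAbove (P t) := ⟨C, fun c hc => hbound t c ht hc⟩
  have hne (t : ℝ) (h0 : 0 ≤ t) : (P t).Nonempty := ⟨_, happ 0 t 0 h0 hP0⟩
  refine ⟨fun t => sSup (P t), fun t h0 ht => ⟨?_, csSup_le (hne t h0) fun c => hbound t c ht⟩,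
    fun s t h0 hst ht => ?_⟩
  · refine le_trans ?_ (le_csSup (hbdd t ht) (happ 0 t 0 h0 hP0))
    positivity
  · rw [le_sub_iff_add_le', ← le_sub_iff_add_le]
    refine csSup_le (hne s h0) fun c hc => ?_
    rw [le_sub_iff_add_le]
    exact le_csSup (hbdd t ht) (happ s t c hst hc)

lemma sum_increments (m : ℕ) (a : Fin (m + 1) → ℝ) :
    ∑ j : Fin m, (a j.succ - a j.castSucc) = a (Fin.last m) - a 0 := by
  induction m with
  | zero => simp
  | succ m ih =>
    rw [Fin.sum_univ_castSucc]
    have := ih fun j => a j.castSucc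
    simp only [Fin.succ_castSucc, Fin.castSucc_zero, Fin.succ_last] at this ⊢
    rw [this]
    ring

lemma conv_ofFn {n : ℕ} {g h : List A → ℝ} (hg : g [] = 1) (hh : h [] = 1) (hn : 0 < n)
    (w : Fin n → A) :
    conv g h (List.ofFn w) - g (List.ofFn w) - h (List.ofFn w) =
      ∑ k ∈ univ.filter (fun k : Fin n => 0 < k.1),
        g (List.ofFn fun j : Fin k.1 =>
          w ⟨j.1, by have h1 := j.isLt; have h2 := k.isLt; omega⟩) *
        h (List.ofFn fun j : Fin (n - k.1) =>
          w ⟨k.1 + j.1, by have h1 := j.isLt; have h2 := k.isLt; omega⟩) := by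
  have ht (k : Fin n) : (List.ofFn fun j : Fin k.1 =>
      w ⟨j.1, by have h1 := j.isLt; have h2 := k.isLt; omega⟩) = (List.ofFn w).take k.1 := by
    refine List.ext_getElem (by simp [k.isLt.le]) fun i h1 h2 => by
      simp only [List.getElem_ofFn, List.getElem_take]
  have hd (k : Fin n) : (List.ofFn fun j : Fin (n - k.1) =>
      w ⟨k.1 + j.1, by have h1 := j.isLt; have h2 := k.isLt; omega⟩) =
      (List.ofFn w).drop k.1 := by
    refine List.ext_getElem (by simp) fun i h1 h2 => by
      simp only [List.getElem_ofFn, List.getElem_drop]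
  simp only [ht, hd]
  obtain ⟨n, rfl⟩ : ∃ m, n = m + 1 := ⟨n - 1, by omega⟩
  rw [conv_eq_proper g h _ (by simp) hg hh, sum_filter, Fin.sum_univ_succ]
  simp only [Fin.val_zero, lt_irrefl, if_false, zero_add, Fin.val_succ, Nat.succ_pos, if_true,
    List.length_ofFn, Nat.add_sub_cancel]
  rw [Fin.sum_univ_eq_sum_range
    (fun k => g ((List.ofFn w).take (k + 1)) * h ((List.ofFn w).drop (k + 1)))]
  ring

end RoughLift

/-- Existence of a geometric rough path with finite `1/(nα)`-variation levels over a
continuous path of finite `1/α`-variation on `[0,T]`. -/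
theorem exists_rough_path_finite_variation
    (α : ℝ) (hα0 : 0 < α) (hα1 : α < 1) (hirr : ¬ ∃ m : ℕ, 1 / α = (m : ℝ))
    (N : ℕ) (hN : N = ⌊1 / α⌋₊) (d : ℕ) (hd : 1 ≤ d) (T : ℝ) (hT : 0 < T)
    (Γ : ℝ → Fin d → ℝ) (hcont : ContinuousOn Γ (Set.Icc 0 T))
    (hvar : ∃ C : ℝ, ∀ (m : ℕ) (τ : Fin (m + 1) → ℝ), Monotone τ →
      τ 0 = 0 → τ (Fin.last m) = T →
      ∑ j : Fin m, ‖Γ (τ j.succ) - Γ (τ j.castSucc)‖ ^ (1 / α) ≤ C) :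
    ∃ X : (n : ℕ) → (Fin n → Fin d) → ℝ → ℝ → ℝ,
      -- (0) level one consists of the increments of Γ
      (∀ (i : Fin d), ∀ t ∈ Set.Icc (0 : ℝ) T, ∀ s ∈ Set.Icc (0 : ℝ) T,
        X 1 (fun _ => i) t s = Γ t i - Γ s i) ∧
      -- (ii) multiplicative/Chen property
      (∀ n : ℕ, 2 ≤ n → n ≤ N → ∀ w : Fin n → Fin d,
        ∀ t ∈ Set.Icc (0 : ℝ) T, ∀ u ∈ Set.Icc (0 : ℝ) T, ∀ s ∈ Set.Icc (0 : ℝ) T,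
        X n w t s - X n w t u - X n w u s =
          ∑ k ∈ Finset.univ.filter (fun k : Fin n => 0 < k.1),
            X k.1 (fun j => w ⟨j.1, by have h1 := j.isLt; have h2 := k.isLt; omega⟩) t u *
              X (n - k.1)
                (fun j => w ⟨k.1 + j.1, by have h1 := j.isLt; have h2 := k.isLt; omega⟩) u s) ∧
      -- (iii) geometric/shuffle property
      (∀ n₁ n₂ : ℕ, 1 ≤ n₁ → 1 ≤ n₂ → n₁ + n₂ ≤ N →
        ∀ (u : Fin n₁ → Fin d) (v : Fin n₂ → Fin d),
        ∀ t ∈ Set.Icc (0 : ℝ) T, ∀ s ∈ Set.Icc (0 : ℝ) T,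
          X n₁ u t s * X n₂ v t s =
            ∑ S : {S : Finset (Fin (n₁ + n₂)) // S.card = n₁},
              X (n₁ + n₂) (shuffleWord u v S.1 S.2) t s) ∧
      -- (i') each level n has finite 1/(nα)-variation
      (∀ n : ℕ, 1 ≤ n → n ≤ N → ∀ w : Fin n → Fin d,
        ∃ C : ℝ, ∀ (m : ℕ) (τ : Fin (m + 1) → ℝ), Monotone τ →
          τ 0 = 0 → τ (Fin.last m) = T →
          ∑ j : Fin m, |X n w (τ j.succ) (τ j.castSucc)| ^ (1 / ((n : ℝ) * α)) ≤ C) := by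
  have hp : (0 : ℝ) < 1 / α := by positivity
  have hN1 : 1 ≤ N := by
    rw [hN]
    exact Nat.le_floor (by rw [Nat.cast_one, le_div_iff₀ hα0]; linarith)
  have hNα : (N : ℝ) * α < 1 := by
    have h1 : (N : ℝ) ≤ 1 / α := by rw [hN]; exact Nat.floor_le hp.le
    have h2 : (N : ℝ) ≠ 1 / α := fun h => hirr ⟨N, h.symm⟩
    exact (lt_div_iff₀ hα0).1 (lt_of_le_of_ne h1 h2)
  obtain ⟨C, hC⟩ := hvar
  obtain ⟨V, hV, hVΓ⟩ := RoughLift.exists_variation_control Γ hC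
  have hC0 : 0 ≤ C := (hV 0 le_rfl hT.le).1.trans (hV 0 le_rfl hT.le).2
  have hC1 : 0 < C + 1 := by linarith
  set v : ℝ → ℝ := fun t => V t / (C + 1) with hv
  have hv0 (t : ℝ) (ht : t ∈ Set.Icc 0 T) : 0 ≤ v t := div_nonneg (hV t ht.1 ht.2).1 hC1.le
  have hv1 (t : ℝ) (ht : t ∈ Set.Icc 0 T) : v t ≤ 1 := by
    rw [hv, div_le_one hC1]
    linarith [(hV t ht.1 ht.2).2]
  have hvm (s t : ℝ) (hs : 0 ≤ s) (hst : s ≤ t) (ht : t ≤ T) : v s ≤ v t := by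
    have := hVΓ s t hs hst ht
    have h0 : 0 ≤ ‖Γ t - Γ s‖ ^ (1 / α) := by positivity
    exact div_le_div_of_nonneg_right (by linarith) hC1.le
  set K : ℝ := (C + 1) ^ α with hK
  have hK0 : 0 ≤ K := by positivity
  have hΓle (s t : ℝ) (hs : 0 ≤ s) (hst : s ≤ t) (ht : t ≤ T) :
      ‖Γ t - Γ s‖ ≤ K * |v t - v s| ^ α := by
    have h1 := hVΓ s t hs hst ht
    have h2 := sub_nonneg.2 (hvm s t hs hst ht)
    have h3 : (C + 1) * (v t - v s) = V t - V s := by simp only [hv]; field_simp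
    rw [abs_of_nonneg h2, hK, ← Real.mul_rpow hC1.le h2, h3]
    calc ‖Γ t - Γ s‖ = (‖Γ t - Γ s‖ ^ (1 / α)) ^ α := by
          rw [← Real.rpow_mul (norm_nonneg _), one_div_mul_cancel hα0.ne', Real.rpow_one]
      _ ≤ (V t - V s) ^ α := Real.rpow_le_rpow (by positivity) h1 hα0.le
  have hΓ (s t : ℝ) (hs : s ∈ Set.Icc 0 T) (ht : t ∈ Set.Icc 0 T) :
      ‖Γ t - Γ s‖ ≤ K * |v t - v s| ^ α := by
    rcases le_total s t with h | h
    · exact hΓle s t hs.1 h ht.2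
    · rw [norm_sub_rev, abs_sub_comm]
      exact hΓle t s ht.1 h hs.2
  have : Nonempty (Set.Icc (0 : ℝ) T) := ⟨⟨0, le_rfl, hT.le⟩⟩
  have hext (i : Fin d) := RoughLift.exists_holder_extension hα0 hα1.le
    (fun t : Set.Icc (0 : ℝ) T => v t) (fun t => Γ t i) hK0
    (fun a b => (norm_le_pi_norm (Γ a - Γ b) i).trans (hΓ b a b.2 a.2))
  choose γ hγ hγv using hext
  obtain ⟨X, hX⟩ := RoughLift.exists_isRoughBelow hα0 (γ := fun t i => γ i t)
    (fun s t a => hγ a t s) (N - 1) (by rwa [Nat.sub_add_cancel hN1])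
  rw [show N - 1 + 2 = N + 1 by omega] at hX
  refine ⟨fun n w t s => X (v t) (v s) (List.ofFn w), ?_, ?_, ?_, ?_⟩
  · intro i t ht s hs
    have := hX.level_one (v t) (v s) i
    rw [hγv i ⟨t, ht⟩, hγv i ⟨s, hs⟩] at this
    simpa using this
  · intro n hn2 hnN w t _ u _ s _
    have h := RoughLift.conv_ofFn (hX.character (v t) (v u)).nil (hX.character (v u) (v s)).nil
      (by omega) w
    rw [hX.chen _ _ _ _ (by rw [List.length_ofFn]; omega)] at h
    exact h
  · intro n₁ n₂ _ _ hn u v' t _ s _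
    rw [RoughLift.sum_shuffleWord hd u v' (X (v t) (v s)),
      (hX.character _ _).mul _ _ (by simp only [List.length_ofFn]; omega)]
  · intro n hn1 hnN w
    obtain ⟨B, hB⟩ := hX.bound
    have hB0 : 0 ≤ B := by
      simpa using (abs_nonneg _).trans (hB 0 1 le_rfl zero_le_one le_rfl [] (by simp))
    refine ⟨B ^ (1 / ((n : ℝ) * α)), fun m τ hτ h0 hl => ?_⟩
    have hmem (j : Fin (m + 1)) : τ j ∈ Set.Icc 0 T :=
      ⟨h0 ▸ hτ (Fin.zero_le j), hl ▸ hτ (Fin.le_last j)⟩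
    have hn0 : (0 : ℝ) < n := by exact_mod_cast hn1
    have hterm (j : Fin m) : |X (v (τ j.succ)) (v (τ j.castSucc)) (List.ofFn w)| ^
        (1 / ((n : ℝ) * α)) ≤
        B ^ (1 / ((n : ℝ) * α)) * (v (τ j.succ) - v (τ j.castSucc)) := by
      have hle := hvm _ _ (hmem j.castSucc).1 (hτ (Fin.castSucc_le_succ j)) (hmem j.succ).2
      have hd0 := sub_nonneg.2 hle
      have h := hB _ _ (hv0 _ (hmem j.castSucc)) hle (hv1 _ (hmem j.succ)) (List.ofFn w)
        (by rw [List.length_ofFn]; omega)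
      rw [List.length_ofFn, ← Real.rpow_natCast, ← Real.rpow_mul hd0] at h
      refine (Real.rpow_le_rpow (abs_nonneg _) h (by positivity)).trans_eq ?_
      rw [Real.mul_rpow hB0 (by positivity), ← Real.rpow_mul hd0, mul_comm α,
        mul_one_div_cancel (by positivity), Real.rpow_one]
    refine (Finset.sum_le_sum fun j _ => hterm j).trans ?_
    rw [← Finset.mul_sum, RoughLift.sum_increments m fun j => v (τ j)]
    have h1 := hv1 _ (hmem (Fin.last m))
    have h2 := hv0 _ (hmem 0)
    exact mul_le_of_le_one_right (by positivity) (by linarith)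
end
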